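/- arXiv:2605.22397 — 2 statements merged into one kernel-verified Lean document; each statement's English description precedes it below -/
import Mathlib

section
/- For all positive integers m, s with m ≥ 2s ≥ 4 and every ε > 0 there exists n_0 such that for all n ≥ n_0 with n divisible by 3: ex_3(n, F_5^S(m,1,K_{s,s})) ≤ e(T_3(n,3)) + 6·ex_3^{bip}(n/3, n/3, K_{1,s,s}) + 3·ex_3(n/3, K_{1,s,s}) + ε·n^{3−1/s}. -/
open Finset

/-- `H` (a 3-graph given by its edge set on vertex type `V`) contains a copy of the
3-graph `F` (given by its edge set on vertex type `W`). -/
def HasCopy {V W : Type*} [DecidableEq V] [DecidableEq W]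
    (H : Finset (Finset V)) (F : Finset (Finset W)) : Prop :=
  ∃ f : W ↪ V, ∀ e ∈ F, e.image f ∈ H

/-- The Turán number `ex_3(n, F)`: the maximum number of hyperedges of an `F`-free
3-uniform hypergraph on `n` vertices. -/
noncomputable def exThree {W : Type*} [DecidableEq W] (n : ℕ) (F : Finset (Finset W)) : ℕ :=
  sSup {k | ∃ H : Finset (Finset (Fin n)), (∀ e ∈ H, e.card = 3) ∧ ¬ HasCopy H F ∧ H.card = k}

/-- The `i`-th part of the balanced tripartition of `Fin n` (vertices with residue `i` mod 3);
the parts have sizes `⌊n/3⌋` or `⌈n/3⌉`. -/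
def turanPart (n : ℕ) (i : Fin 3) : Finset (Fin n) :=
  Finset.univ.filter (fun v => (v : ℕ) % 3 = (i : ℕ))

/-- The balanced complete tripartite 3-graph `T_3(n,3)`: hyperedges are exactly the triples
with one vertex in each part of the balanced tripartition. -/
def T3 (n : ℕ) : Finset (Finset (Fin n)) :=
  Finset.univ.filter (fun e => e.card = 3 ∧ ∀ i : Fin 3, (e ∩ turanPart n i).card = 1)

/-- The 3-graph `F_5` on `{f_1, …, f_5}` with hyperedges `f_1f_2f_3, f_1f_2f_4, f_3f_4f_5`. -/
def F5 : Finset (Finset (Fin 5)) := {{0,1,2},{0,1,3},{2,3,4}}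

/-- `F_5(f_5;t)`: `F_5` with the vertex `f_5` blown up to `t` copies.
Here `inl 0, inl 1, inl 2, inl 3` play the roles of `f_1,f_2,f_3,f_4` and the
vertices `inr j` are the `t` copies of `f_5`. -/
def F5b5 (t : ℕ) : Finset (Finset (Fin 4 ⊕ Fin t)) :=
  ({({Sum.inl 0, Sum.inl 1, Sum.inl 2} : Finset (Fin 4 ⊕ Fin t)),
    ({Sum.inl 0, Sum.inl 1, Sum.inl 3} : Finset (Fin 4 ⊕ Fin t))} :
      Finset (Finset (Fin 4 ⊕ Fin t))) ∪
  Finset.univ.image (fun j : Fin t => ({Sum.inl 2, Sum.inl 3, Sum.inr j} : Finset (Fin 4 ⊕ Fin t)))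

/-- `F_5(f_3;t)`: `F_5` with the vertex `f_3` blown up to `t` copies.
Here `inl 0, inl 1, inl 2, inl 3` play the roles of `f_1,f_2,f_4,f_5` and the
vertices `inr j` are the `t` copies of `f_3`. -/
def F5b3 (t : ℕ) : Finset (Finset (Fin 4 ⊕ Fin t)) :=
  ({({Sum.inl 0, Sum.inl 1, Sum.inl 2} : Finset (Fin 4 ⊕ Fin t))} :
      Finset (Finset (Fin 4 ⊕ Fin t))) ∪
  Finset.univ.image (fun j : Fin t => ({Sum.inl 0, Sum.inl 1, Sum.inr j} : Finset (Fin 4 ⊕ Fin t))) ∪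
  Finset.univ.image (fun j : Fin t => ({Sum.inr j, Sum.inl 2, Sum.inl 3} : Finset (Fin 4 ⊕ Fin t)))

/-- `S^t(N)` (the size of `D(N,3,t,2)`): the maximum number of hyperedges of a 3-graph on `N`
vertices in which every pair of vertices is contained in at most `t-1` hyperedges. -/
noncomputable def Dmax (N t : ℕ) : ℕ :=
  sSup {k | ∃ H : Finset (Finset (Fin N)), (∀ e ∈ H, e.card = 3) ∧
    (∀ u v : Fin N, u ≠ v → (H.filter (fun e => u ∈ e ∧ v ∈ e)).card ≤ t - 1) ∧ H.card = k}

/-- `e(T_3(n,3)^{t+})`: the number of hyperedges of `T_3(n,3)` together with a maximum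
3-graph inside each part in which every pair of vertices lies in at most `t-1` hyperedges. -/
noncomputable def eT3plus (n t : ℕ) : ℕ :=
  (T3 n).card + ∑ i : Fin 3, Dmax ((turanPart n i).card) t

/-- `F` is a subgraph of a blow-up of `F_5`: every edge is a triple, and there is a map
to `V(F_5)` that is injective on each edge and sends each edge to an edge of `F_5`. -/
def IsSubBlowupF5 {W : Type*} [DecidableEq W] (F : Finset (Finset W)) : Prop :=
  (∀ e ∈ F, e.card = 3) ∧ ∃ φ : W → Fin 5, ∀ e ∈ F, (e.image φ).card = 3 ∧ e.image φ ∈ F5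

/-- The complete tripartite 3-graph with parts `A`, `B`, `C`: all triples with exactly
one vertex in each of `A`, `B`, `C`. -/
def tripartiteEdges {n : ℕ} (A B C : Finset (Fin n)) : Finset (Finset (Fin n)) :=
  Finset.univ.filter (fun e =>
    (e ∩ A).card = 1 ∧ (e ∩ B).card = 1 ∧ (e ∩ C).card = 1 ∧ e.card = 3)

/-- The complete 3-partite 3-graph `K_{t,s,s}` with parts of sizes `t`, `s`, `s`. -/
def Ktss (t s : ℕ) : Finset (Finset (Fin t ⊕ Fin s ⊕ Fin s)) :=
  Finset.univ.image (fun x : Fin t × Fin s × Fin s =>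
    ({Sum.inl x.1, Sum.inr (Sum.inl x.2.1), Sum.inr (Sum.inr x.2.2)} :
      Finset (Fin t ⊕ Fin s ⊕ Fin s)))

/-- All hyperedges of `H` consist of one vertex of the `A`-side (`Fin mA`) and two
vertices of the `B`-side (`Fin nB`). -/
def BipShape (mA nB : ℕ) (H : Finset (Finset (Fin mA ⊕ Fin nB))) : Prop :=
  ∀ e ∈ H, ∃ a : Fin mA, ∃ b c : Fin nB, b ≠ c ∧
    e = ({Sum.inl a, Sum.inr b, Sum.inr c} : Finset (Fin mA ⊕ Fin nB))

/-- `H` contains a copy of `K_{t,s,s}` whose `t`-vertex part lies on the `A`-side and whose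
two `s`-vertex parts lie on the `B`-side. -/
def HasBipKtss (mA nB t s : ℕ) (H : Finset (Finset (Fin mA ⊕ Fin nB))) : Prop :=
  ∃ (T : Finset (Fin mA)) (S0 S1 : Finset (Fin nB)), T.card = t ∧
    S0.card = s ∧ S1.card = s ∧ Disjoint S0 S1 ∧
    ∀ a ∈ T, ∀ b ∈ S0, ∀ c ∈ S1,
      ({Sum.inl a, Sum.inr b, Sum.inr c} : Finset (Fin mA ⊕ Fin nB)) ∈ H

/-- The bipartite Turán number `ex_3^{bip}(mA, nB, K_{t,s,s})`. -/
noncomputable def exBip (mA nB t s : ℕ) : ℕ :=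
  sSup {k | ∃ H : Finset (Finset (Fin mA ⊕ Fin nB)),
    BipShape mA nB H ∧ ¬ HasBipKtss mA nB t s H ∧ H.card = k}

/-- The `s`-set `S_0` inside the residue-0 part of `T_3(3m,3)`. -/
def S0set (m s : ℕ) (h : 2*s ≤ m) : Finset (Fin (3*m)) :=
  Finset.univ.image (fun i : Fin s => (⟨3*i.val, by have := i.isLt; omega⟩ : Fin (3*m)))

/-- The `s`-set `S_1` inside the residue-0 part of `T_3(3m,3)`, disjoint from `S_0`. -/
def S1set (m s : ℕ) (h : 2*s ≤ m) : Finset (Fin (3*m)) :=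
  Finset.univ.image (fun i : Fin s => (⟨3*(s+i.val), by have := i.isLt; omega⟩ : Fin (3*m)))

/-- The 3-graph `F_5^S(m,t,K_{s,s})`: `T_3(3m,3)` (on the `inl` vertices) together with a set
`T` of `t` new vertices (the `inr` vertices) and all triples consisting of one vertex of `T`,
one vertex of `S_0` and one vertex of `S_1`. -/
def F5Stss (m t s : ℕ) (h : 2*s ≤ m) : Finset (Finset (Fin (3*m) ⊕ Fin t)) :=
  (T3 (3*m)).image (fun e => e.image Sum.inl) ∪
  Finset.univ.biUnion (fun j : Fin t =>
    ((S0set m s h) ×ˢ (S1set m s h)).image (fun p =>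
      ({Sum.inr j, Sum.inl p.1, Sum.inl p.2} : Finset (Fin (3*m) ⊕ Fin t))))

/-- `F_sim(t)`: the 3-graph with hyperedges `f_1f_2f_3, f_1f_2f_4, f_3f_4f_5, f_5f_6f_7,
f_6f_7f_8` in which `f_8` is blown up to `t` copies. Here `inl 0, …, inl 6` play the roles
of `f_1, …, f_7` and the vertices `inr j` are the `t` copies of `f_8`. -/
def Fsim (t : ℕ) : Finset (Finset (Fin 7 ⊕ Fin t)) :=
  ({({Sum.inl 0, Sum.inl 1, Sum.inl 2} : Finset (Fin 7 ⊕ Fin t)),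
    ({Sum.inl 0, Sum.inl 1, Sum.inl 3} : Finset (Fin 7 ⊕ Fin t)),
    ({Sum.inl 2, Sum.inl 3, Sum.inl 4} : Finset (Fin 7 ⊕ Fin t)),
    ({Sum.inl 4, Sum.inl 5, Sum.inl 6} : Finset (Fin 7 ⊕ Fin t))} :
      Finset (Finset (Fin 7 ⊕ Fin t))) ∪
  Finset.univ.image (fun j : Fin t => ({Sum.inl 5, Sum.inl 6, Sum.inr j} : Finset (Fin 7 ⊕ Fin t)))

/-- The 3-graph with parts `A`, `B`, `C` and an extra clique `X`: its hyperedges are the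
triples with one vertex in each of `A`, `B`, `C`, all 3-subsets of `X`, and the triples with
one vertex in `X` and two vertices in a common part among `A`, `B`, `C`. -/
def simConstr (n : ℕ) (A B C X : Finset (Fin n)) : Finset (Finset (Fin n)) :=
  Finset.univ.filter (fun e => e.card = 3 ∧
    (((e ∩ A).card = 1 ∧ (e ∩ B).card = 1 ∧ (e ∩ C).card = 1) ∨
     e ⊆ X ∨
     ((e ∩ X).card = 1 ∧ ((e ∩ A).card = 2 ∨ (e ∩ B).card = 2 ∨ (e ∩ C).card = 2))))

/-- `F_5^S(m)`: `T_3(3m,3)` together with one new vertex `v = inr ()` and one hyperedge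
consisting of `v` and two vertices (`0` and `3`) lying in one part of `T_3(3m,3)`. -/
def F5Sm (m : ℕ) (hm : 2 ≤ m) : Finset (Finset (Fin (3*m) ⊕ Unit)) :=
  (T3 (3*m)).image (fun e => e.image Sum.inl) ∪
  {({Sum.inr (), Sum.inl ⟨0, by omega⟩, Sum.inl ⟨3, by omega⟩} : Finset (Fin (3*m) ⊕ Unit))}

/-- The disjoint union of `k` vertex-disjoint copies of the 3-graph `F`. -/
def copies (k : ℕ) {W : Type*} [DecidableEq W] (F : Finset (Finset W)) :
    Finset (Finset (Fin k × W)) :=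
  Finset.univ.biUnion (fun j : Fin k => F.image (fun e => e.image (fun w => (j, w))))

/-- The 3-graph `G(t,m,n)` (it does not depend on `m`): the vertices `v < t` form the set
`T`, the remaining `n - t` vertices carry a copy of `T_3(n-t,3)` (parts by residue of
`v - t` mod 3), and the hyperedges are those of this `T_3(n-t,3)` together with all
3-sets of vertices intersecting `T`. -/
def Gtmn (t n : ℕ) : Finset (Finset (Fin n)) :=
  Finset.univ.filter (fun e => e.card = 3 ∧
    ((∃ v ∈ e, (v : ℕ) < t) ∨
     (∀ i : Fin 3, (e.filter (fun v : Fin n => t ≤ (v : ℕ) ∧ ((v : ℕ) - t) % 3 = (i : ℕ))).card = 1)))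

/-- The blow-up of `F_5` in which every vertex is replaced by `t` copies:
the vertex `(i, j)` is the `j`-th copy of `f_{i+1}`. -/
def F5blowAll (t : ℕ) : Finset (Finset (Fin 5 × Fin t)) :=
  Finset.univ.biUnion (fun x : Fin t × Fin t × Fin t =>
    ({ ({((0:Fin 5), x.1), ((1:Fin 5), x.2.1), ((2:Fin 5), x.2.2)} : Finset (Fin 5 × Fin t)),
       ({((0:Fin 5), x.1), ((1:Fin 5), x.2.1), ((3:Fin 5), x.2.2)} : Finset (Fin 5 × Fin t)),
       ({((2:Fin 5), x.1), ((3:Fin 5), x.2.1), ((4:Fin 5), x.2.2)} : Finset (Fin 5 × Fin t)) } :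
      Finset (Finset (Fin 5 × Fin t))))

open Classical in
/-- The real-valued indicator of a proposition. -/
noncomputable def ind (P : Prop) : ℝ := if P then 1 else 0

lemma ind_nonneg (P : Prop) : 0 ≤ ind P := by unfold ind; split_ifs <;> norm_num

lemma ind_le_one (P : Prop) : ind P ≤ 1 := by unfold ind; split_ifs <;> norm_num

lemma ind_of {P : Prop} (h : P) : ind P = 1 := by simp [ind, h]

lemma ind_of_not {P : Prop} (h : ¬ P) : ind P = 0 := by simp [ind, h]

lemma ind_mono {P Q : Prop} (h : P → Q) : ind P ≤ ind Q := by
  unfold ind; split_ifs <;> first | tauto | norm_num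

lemma ind_congr {P Q : Prop} (h : P ↔ Q) : ind P = ind Q := by rw [propext h]

lemma ind_and (P Q : Prop) : ind (P ∧ Q) = ind P * ind Q := by
  unfold ind; split_ifs <;> first | tauto | norm_num

lemma ind_not (P : Prop) : ind (¬ P) = 1 - ind P := by
  unfold ind; split_ifs <;> first | tauto | norm_num

lemma ind_or_le (P Q : Prop) : ind (P ∨ Q) ≤ ind P + ind Q := by
  unfold ind; split_ifs <;> first | tauto | norm_num

lemma ind_forall {ι : Type*} [Fintype ι] (P : ι → Prop) : ind (∀ i, P i) = ∏ i, ind (P i) := by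
  by_cases h : ∀ i, P i
  · rw [ind_of h, prod_eq_one fun i _ => ind_of (h i)]
  · rw [ind_of_not h]
    push Not at h
    obtain ⟨i, hi⟩ := h
    exact (prod_eq_zero (mem_univ i) (ind_of_not hi)).symm

lemma sum_ind_eq_card {α : Type*} (s : Finset α) (P : α → Prop) [DecidablePred P] :
    ∑ a ∈ s, ind (P a) = (s.filter P).card := by
  unfold ind
  rw [card_filter, Nat.cast_sum]
  exact sum_congr rfl fun a _ => by split_ifs <;> simp

/-- The number of non-injective `t`-tuples is at most `t ^ 2 * |V| ^ (t - 1)`. -/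
lemma sum_not_injective_le (t : ℕ) (V : Type*) [Fintype V] :
    (∑ g : Fin t → V, ind (¬ Function.Injective g)) * Fintype.card V
      ≤ (t : ℝ) ^ 2 * (Fintype.card V : ℝ) ^ t := by
  classical
  have h1 : ∀ i j : Fin t, i ≠ j →
      (∑ g : Fin t → V, ind (g i = g j)) * Fintype.card V ≤ (Fintype.card V : ℝ) ^ t := by
    intro i j hij
    rw [sum_ind_eq_card]
    have : ((univ.filter fun g : Fin t → V => g i = g j) ×ˢ (univ : Finset V)).card
        ≤ (univ : Finset (Fin t → V)).card := by
      apply card_le_card_of_injOn (fun p => Function.update p.1 j p.2) (by simp)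
      rintro ⟨g, v⟩ hg ⟨g', v'⟩ hg' heq
      simp only [coe_product, Set.mem_prod, mem_coe, mem_filter, mem_univ, true_and,
        and_true] at hg hg' heq
      have hv : v = v' := by simpa using congrFun heq j
      have hg2 : g = g' := by
        funext k
        by_cases hk : k = j
        · subst hk
          have := congrFun heq i
          simp only [Function.update_of_ne hij] at this
          rw [← hg, ← hg', this]
        · simpa [Function.update_of_ne hk] using congrFun heq k
      rw [hv, hg2]
    rw [card_product, card_univ, card_univ, Fintype.card_fun, Fintype.card_fin] at this
    exact_mod_cast this
  have h2 : ∀ g : Fin t → V, ind (¬ Function.Injective g)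
      ≤ ∑ i : Fin t, ∑ j : Fin t, ind (i ≠ j) * ind (g i = g j) := by
    intro g
    by_cases h : Function.Injective g
    · rw [ind_of_not (not_not.2 h)]
      exact sum_nonneg fun i _ => sum_nonneg fun j _ => mul_nonneg (ind_nonneg _) (ind_nonneg _)
    · rw [ind_of h]
      unfold Function.Injective at h
      push Not at h
      obtain ⟨i, j, he, hne⟩ := h
      have e1 : (1 : ℝ) = ind (i ≠ j) * ind (g i = g j) := by rw [ind_of hne, ind_of he]; norm_num
      rw [e1]
      refine le_trans ?_ (single_le_sum (f := fun i => ∑ j : Fin t, ind (i ≠ j) * ind (g i = g j))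
        (fun i _ => sum_nonneg fun j _ => mul_nonneg (ind_nonneg _) (ind_nonneg _)) (mem_univ i))
      exact single_le_sum (f := fun j => ind (i ≠ j) * ind (g i = g j))
        (fun j _ => mul_nonneg (ind_nonneg _) (ind_nonneg _)) (mem_univ j)
  calc (∑ g : Fin t → V, ind (¬ Function.Injective g)) * Fintype.card V
      ≤ (∑ g : Fin t → V, ∑ i : Fin t, ∑ j : Fin t, ind (i ≠ j) * ind (g i = g j))
          * Fintype.card V := by
        gcongr with g; exact h2 g
    _ = ∑ i : Fin t, ∑ j : Fin t, ind (i ≠ j) *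
          ((∑ g : Fin t → V, ind (g i = g j)) * Fintype.card V) := by
        rw [sum_comm, sum_mul]
        refine sum_congr rfl fun i _ => ?_
        rw [sum_comm, sum_mul]
        refine sum_congr rfl fun j _ => ?_
        rw [← mul_sum]; ring
    _ ≤ ∑ i : Fin t, ∑ j : Fin t, (Fintype.card V : ℝ) ^ t := by
        refine sum_le_sum fun i _ => sum_le_sum fun j _ => ?_
        by_cases hij : i = j
        · rw [ind_of_not (by simpa using hij), zero_mul]; positivity
        · rw [ind_of hij, one_mul]; exact h1 i j hij
    _ = (t : ℝ) ^ 2 * (Fintype.card V : ℝ) ^ t := by simp; ring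

/-- The number of pairs (point, tuple of neighbours) as a power sum. -/
lemma sum_tuples_eq {X V : Type*} [Fintype X] [Fintype V] (R : X → V → Prop) (t : ℕ) :
    ∑ g : Fin t → V, ∑ x, ind (∀ i, R x (g i)) = ∑ x, (∑ v, ind (R x v)) ^ t := by
  rw [sum_comm]
  refine sum_congr rfl fun x _ => ?_
  rw [Fintype.sum_pow]
  exact sum_congr rfl fun g _ => ind_forall _

lemma density_pow_le {X V : Type*} [Fintype X] [Nonempty X] [Fintype V] (R : X → V → Prop)
    (t : ℕ) {c : ℝ} (hc : 0 < c)
    (h : c * Fintype.card X * Fintype.card V ≤ ∑ x, ∑ v, ind (R x v)) :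
    c ^ t * Fintype.card X * (Fintype.card V : ℝ) ^ t ≤ ∑ x, (∑ v, ind (R x v)) ^ t := by
  have hX : (0 : ℝ) < Fintype.card X := by exact_mod_cast Fintype.card_pos
  cases t with
  | zero => simp
  | succ t =>
    have key := pow_sum_div_card_le_sum_pow (s := (univ : Finset X))
      (f := fun x => ∑ v, ind (R x v)) (n := t)
      (fun x _ => sum_nonneg fun v _ => ind_nonneg _)
    refine le_trans ?_ key
    rw [le_div_iff₀ (by rw [card_univ]; positivity), card_univ]
    calc c ^ (t + 1) * Fintype.card X * (Fintype.card V : ℝ) ^ (t + 1) * (Fintype.card X : ℝ) ^ t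
        = (c * Fintype.card X * Fintype.card V) ^ (t + 1) := by ring
      _ ≤ _ := by gcongr

/-- A dense relation has an injective tuple with many common neighbours. -/
lemma exists_injective_tuple {X V : Type*} [Fintype X] [Nonempty X] [Fintype V]
    (R : X → V → Prop) (t : ℕ) {c : ℝ} (hc : 0 < c)
    (hV : 2 * (t : ℝ) ^ 2 < c ^ t * Fintype.card V)
    (h : c * Fintype.card X * Fintype.card V ≤ ∑ x, ∑ v, ind (R x v)) :
    ∃ g : Fin t → V, Function.Injective g ∧
      c ^ t / 2 * Fintype.card X ≤ ∑ x, ind (∀ i, R x (g i)) := by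
  by_contra! hno
  have hX : (0 : ℝ) < Fintype.card X := by exact_mod_cast Fintype.card_pos
  have hVpos : (0 : ℝ) < Fintype.card V := by
    by_contra hneg
    have : (Fintype.card V : ℝ) = 0 := le_antisymm (not_lt.1 hneg) (Nat.cast_nonneg _)
    rw [this] at hV
    nlinarith [sq_nonneg (t : ℝ)]
  have h1 := density_pow_le R t hc h
  rw [← sum_tuples_eq] at h1
  have h2 : ∑ g : Fin t → V, ∑ x, ind (∀ i, R x (g i))
      ≤ ∑ g : Fin t → V, (c ^ t / 2 * Fintype.card X
          + ind (¬ Function.Injective g) * Fintype.card X) := by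
    refine sum_le_sum fun g _ => ?_
    by_cases hg : Function.Injective g
    · rw [ind_of_not (not_not.2 hg)]
      linarith [hno g hg]
    · rw [ind_of hg]
      have : ∑ x, ind (∀ i, R x (g i)) ≤ ∑ x : X, 1 := sum_le_sum fun x _ => ind_le_one _
      simp only [sum_const, card_univ, nsmul_eq_mul, mul_one] at this
      have : 0 < c ^ t / 2 * Fintype.card X := by positivity
      linarith
  rw [sum_add_distrib, ← sum_mul univ (fun g : Fin t → V => ind (¬ Function.Injective g))] at h2
  simp only [sum_const, card_univ, nsmul_eq_mul, Fintype.card_fun, Fintype.card_fin,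
    Nat.cast_pow] at h2
  have h3 := sum_not_injective_le t V
  set B := ∑ g : Fin t → V, ind (¬ Function.Injective g)
  set v := (Fintype.card V : ℝ)
  set N := (Fintype.card X : ℝ)
  have h4 : c ^ t / 2 * v ^ t * N ≤ B * N := by nlinarith
  have h5 : c ^ t / 2 * v ^ t ≤ B := le_of_mul_le_mul_right h4 hX
  have h6 : c ^ t / 2 * v ^ t * v ≤ t ^ 2 * v ^ t := (mul_le_mul_of_nonneg_right h5 hVpos.le).trans h3
  have h7 : 0 < v ^ t := by positivity
  nlinarith

lemma distinct_of_card_three {V : Type*} [DecidableEq V] {a b c : V}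
    (h : ({a, b, c} : Finset V).card = 3) : a ≠ b ∧ a ≠ c ∧ b ≠ c := by
  refine ⟨?_, ?_, ?_⟩
  · rintro rfl
    have := card_le_two (a := a) (b := c)
    simp at h; omega
  · rintro rfl
    have := card_le_two (a := b) (b := a)
    rw [insert_eq_of_mem (by simp)] at h; omega
  · rintro rfl
    have := card_le_two (a := a) (b := b)
    simp at h; omega

lemma exists_of_mem_T3 {m : ℕ} {e : Finset (Fin (3 * m))} (he : e ∈ T3 (3 * m)) :
    ∃ x y z : Fin (3 * m), (x : ℕ) % 3 = 0 ∧ (y : ℕ) % 3 = 1 ∧ (z : ℕ) % 3 = 2 ∧ e = {x, y, z} := by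
  simp only [T3, mem_filter, mem_univ, true_and] at he
  obtain ⟨hcard, hpart⟩ := he
  have key : ∀ i : Fin 3, ∃ x ∈ e, (x : ℕ) % 3 = i := by
    intro i
    obtain ⟨x, hx⟩ := card_eq_one.1 (hpart i)
    have : x ∈ e ∩ turanPart (3 * m) i := by rw [hx]; simp
    simp only [turanPart, mem_inter, mem_filter, mem_univ, true_and] at this
    exact ⟨x, this⟩
  obtain ⟨x, hx, hx0⟩ := key 0
  obtain ⟨y, hy, hy0⟩ := key 1
  obtain ⟨z, hz, hz0⟩ := key 2
  simp only [Fin.val_zero, Fin.val_one, Fin.val_two] at hx0 hy0 hz0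
  refine ⟨x, y, z, hx0, hy0, hz0, ?_⟩
  symm
  apply eq_of_subset_of_card_le
  · intro w; simp only [mem_insert, mem_singleton]; rintro (rfl | rfl | rfl) <;> assumption
  · have hxy : x ≠ y := by rintro rfl; omega
    have hxz : x ≠ z := by rintro rfl; omega
    have hyz : y ≠ z := by rintro rfl; omega
    rw [hcard, card_insert_of_notMem (by simp [hxy, hxz]), card_pair hyz]

/-- A copy of `F_5^S(m, 1, K_{s,s})` from explicit parts. -/
lemma hasCopy_F5Stss {V : Type*} [DecidableEq V] {m s : ℕ} (hm : 2 * s ≤ m)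
    {H : Finset (Finset V)} (h3 : ∀ e ∈ H, e.card = 3) (a b c : Fin m → V) (v : V)
    (ha : Function.Injective a) (hb : Function.Injective b) (hc : Function.Injective c)
    (hva : ∀ i, a i ≠ v) (hvb : ∀ i, b i ≠ v) (hvc : ∀ i, c i ≠ v)
    (habc : ∀ i j k, ({a i, b j, c k} : Finset V) ∈ H)
    (hv : ∀ i j : Fin m, (i : ℕ) < s → s ≤ (j : ℕ) → (j : ℕ) < 2 * s →
      ({v, a i, a j} : Finset V) ∈ H) :
    HasCopy H (F5Stss m 1 s hm) := by
  have hab : ∀ i j, a i ≠ b j := fun i j => (distinct_of_card_three (h3 _ (habc i j i))).1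
  have hac : ∀ i j, a i ≠ c j := fun i j => (distinct_of_card_three (h3 _ (habc i i j))).2.1
  have hbc : ∀ i j, b i ≠ c j := fun i j => (distinct_of_card_three (h3 _ (habc i i j))).2.2
  set F : Fin (3 * m) → V := fun k =>
    if (k : ℕ) % 3 = 0 then a ⟨k / 3, by omega⟩ else
      if (k : ℕ) % 3 = 1 then b ⟨k / 3, by omega⟩ else c ⟨k / 3, by omega⟩ with hF
  have hFv : ∀ k, F k ≠ v := by
    intro k; simp only [hF]; split_ifs
    · exact hva _
    · exact hvb _
    · exact hvc _
  have hFinj : Function.Injective F := by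
    intro k l hkl
    simp only [hF] at hkl
    have hk := Nat.mod_lt (k : ℕ) (show 0 < 3 by norm_num)
    have hl := Nat.mod_lt (l : ℕ) (show 0 < 3 by norm_num)
    split_ifs at hkl
    · have := congrArg Fin.val (ha hkl); simp only at this; ext; omega
    · exact absurd hkl (hab _ _)
    · exact absurd hkl (hac _ _)
    · exact absurd hkl.symm (hab _ _)
    · have := congrArg Fin.val (hb hkl); simp only at this; ext; omega
    · exact absurd hkl (hbc _ _)
    · exact absurd hkl.symm (hac _ _)
    · exact absurd hkl.symm (hbc _ _)
    · have := congrArg Fin.val (hc hkl); simp only at this; ext; omega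
  refine ⟨⟨Sum.elim F (fun _ => v), ?_⟩, ?_⟩
  · rintro (k | k) (l | l) hkl
    · simp only [Sum.elim_inl] at hkl; rw [hFinj hkl]
    · exact absurd hkl (hFv _)
    · exact absurd hkl.symm (hFv _)
    · rw [Subsingleton.elim k l]
  · intro e he
    change e.image (Sum.elim F fun _ => v) ∈ H
    simp only [F5Stss, mem_union, mem_image, mem_biUnion, mem_univ, true_and, mem_product,
      S0set, S1set] at he
    rcases he with ⟨e', he', rfl⟩ | ⟨j, ⟨x, y⟩, ⟨⟨i0, hi0⟩, ⟨i1, hi1⟩⟩, rfl⟩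
    · obtain ⟨x, y, z, hx, hy, hz, rfl⟩ := exists_of_mem_T3 he'
      have : F x = a ⟨x / 3, by omega⟩ ∧ F y = b ⟨y / 3, by omega⟩ ∧ F z = c ⟨z / 3, by omega⟩ := by
        simp [hF, hx, hy, hz]
      simp only [image_insert, image_singleton, Sum.elim_inl,
        this.1, this.2.1, this.2.2]
      exact habc _ _ _
    · simp only at hi0 hi1
      subst hi0 hi1
      have e0 : F ⟨3 * i0.val, by omega⟩ = a ⟨i0, by omega⟩ := by simp [hF]
      have e1 : F ⟨3 * (s + i1.val), by omega⟩ = a ⟨s + i1, by omega⟩ := by simp [hF]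
      simp only [image_insert, image_singleton, Sum.elim_inl,
        Sum.elim_inr, e0, e1]
      have l0 := i0.isLt
      have l1 := i1.isLt
      exact hv ⟨i0, by omega⟩ ⟨s + i1, by omega⟩ l0 (Nat.le_add_right _ _) (by simp only; omega)

/-- Many copies of `F_5` whose vertex `f_3` lies in a given large set `Y` force a copy of
`F_5^S(m, 1, K_{s,s})`. -/
lemma exists_hasCopy_of_dense_F5 (m s : ℕ) (hs : 2 ≤ s) (hm : 2 * s ≤ m) (c : ℝ) (hc : 0 < c) :
    ∃ K : ℕ, ∀ (V : Type) [Fintype V] [DecidableEq V] (H : Finset (Finset V)) (Y : Finset V),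
      (∀ e ∈ H, e.card = 3) → K ≤ Y.card →
      c * Y.card * (Fintype.card V : ℝ) ^ 4 ≤ ∑ w ∈ Y, ∑ y, ∑ q, ∑ p, ∑ x,
        ind (({p, q, w} : Finset V) ∈ H ∧ ({p, q, x} : Finset V) ∈ H ∧
          ({w, x, y} : Finset V) ∈ H) →
      HasCopy H (F5Stss m 1 s hm) := by
  set c1 := c ^ m / 2 with hc1
  set c2 := c1 ^ m / 2 with hc2
  set c3 := c2 ^ m / 2 with hc3
  set c4 := c3 ^ s / 2 with hc4
  have p1 : 0 < c1 := by positivity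
  have p2 : 0 < c2 := by positivity
  have p3 : 0 < c3 := by positivity
  have p4 : 0 < c4 := by positivity
  obtain ⟨K, hK⟩ := exists_nat_gt
    (2 * (m : ℝ) ^ 2 / c ^ m + 2 * (m : ℝ) ^ 2 / c1 ^ m + 2 * (m : ℝ) ^ 2 / c2 ^ m
      + 2 * (s : ℝ) ^ 2 / c3 ^ s + 2 * m / c4)
  refine ⟨K, fun V _ _ H Y h3 hY hcount => ?_⟩
  have n1 : 0 ≤ 2 * (m : ℝ) ^ 2 / c ^ m := by positivity
  have n2 : 0 ≤ 2 * (m : ℝ) ^ 2 / c1 ^ m := by positivity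
  have n3 : 0 ≤ 2 * (m : ℝ) ^ 2 / c2 ^ m := by positivity
  have n4 : 0 ≤ 2 * (s : ℝ) ^ 2 / c3 ^ s := by positivity
  have n5 : 0 ≤ 2 * m / c4 := by positivity
  have hYK : (K : ℝ) ≤ Y.card := by exact_mod_cast hY
  have hYV : (Y.card : ℝ) ≤ Fintype.card V := by exact_mod_cast card_le_univ Y
  have hYne : Y.Nonempty := by
    rw [← card_pos]
    have : (0 : ℝ) < Y.card := by linarith
    exact_mod_cast this
  obtain ⟨y0, hy0⟩ := hYne
  have : Nonempty V := ⟨y0⟩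
  have : Nonempty Y := ⟨⟨y0, hy0⟩⟩
  have big : ∀ {A B D : ℝ}, 0 < B → A / B < D → A < B * D := by
    intro A B D hB h; rwa [div_lt_iff₀ hB, mul_comm] at h
  rw [← sum_coe_sort Y] at hcount
  obtain ⟨x, hx, hcx⟩ := exists_injective_tuple (X := (Y × V) × V × V) (V := V)
    (fun z x => ({z.2.2, z.2.1, (z.1.1 : V)} : Finset V) ∈ H ∧ ({z.2.2, z.2.1, x} : Finset V) ∈ H ∧
          ({(z.1.1 : V), x, z.1.2} : Finset V) ∈ H) m hc (big (by positivity) (by linarith))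
    (by
      simp only [Fintype.sum_prod_type]
      convert hcount using 1
      simp; ring)
  rw [← hc1] at hcx
  obtain ⟨p, hp, hcp⟩ := exists_injective_tuple (X := (Y × V) × V) (V := V)
    (fun z p => ∀ i, ({p, z.2, (z.1.1 : V)} : Finset V) ∈ H ∧ ({p, z.2, x i} : Finset V) ∈ H ∧
          ({(z.1.1 : V), x i, z.1.2} : Finset V) ∈ H) m p1 (big (by positivity) (by linarith))
    (by
      simp only [Fintype.sum_prod_type] at hcx ⊢
      convert hcx using 1
      simp; ring)
  rw [← hc2] at hcp
  obtain ⟨q, hq, hcq⟩ := exists_injective_tuple (X := Y × V) (V := V)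
    (fun z q => ∀ j i, ({p j, q, (z.1 : V)} : Finset V) ∈ H ∧ ({p j, q, x i} : Finset V) ∈ H ∧
          ({(z.1 : V), x i, z.2} : Finset V) ∈ H) m p2 (big (by positivity) (by linarith))
    (by
      simp only [Fintype.sum_prod_type] at hcp ⊢
      convert hcp using 1
      simp; ring)
  rw [← hc3] at hcq
  obtain ⟨w, hw, hcw⟩ := exists_injective_tuple (X := V) (V := Y)
    (fun z w => ∀ k j i, ({p j, q k, (w : V)} : Finset V) ∈ H ∧ ({p j, q k, x i} : Finset V) ∈ H ∧
          ({(w : V), x i, z} : Finset V) ∈ H) s p3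
    (big (by positivity) (by rw [Fintype.card_coe]; linarith))
    (by
      simp only [Fintype.sum_prod_type] at hcq ⊢
      rw [sum_comm]
      convert hcq using 1
      simp; ring)
  rw [← hc4, sum_ind_eq_card] at hcw
  obtain ⟨y, hy, hyn⟩ : ∃ y ∈ univ.filter (fun z => ∀ l k j i,
      ({p j, q k, (w l : V)} : Finset V) ∈ H ∧ ({p j, q k, x i} : Finset V) ∈ H ∧
          ({(w l : V), x i, z} : Finset V) ∈ H), y ∉ univ.image p ∪ univ.image q := by
    apply exists_mem_notMem_of_card_lt_card
    have e1 : (univ.image p ∪ univ.image q).card ≤ 2 * m := by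
      refine (card_union_le _ _).trans ?_
      have := card_image_le (s := univ) (f := p)
      have := card_image_le (s := univ) (f := q)
      simp only [card_univ, Fintype.card_fin] at *
      omega
    have e2 : (2 * m : ℝ) < c4 * Fintype.card V := big p4 (by linarith)
    have e3 := e2.trans_le hcw
    exact lt_of_le_of_lt e1 ((Nat.cast_lt (α := ℝ)).1 (by push_cast; exact e3))
  simp only [mem_filter, mem_univ, true_and] at hy
  simp only [mem_union, mem_image, mem_univ, true_and, not_or, not_exists] at hyn
  set a : Fin m → V := fun i => if h : (i : ℕ) < s then w ⟨i, h⟩ else x i with ha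
  have i0 : Fin m := ⟨0, by omega⟩
  have l0 : Fin s := ⟨0, by omega⟩
  have hwx : ∀ l i, (w l : V) ≠ x i := fun l i =>
    (distinct_of_card_three (h3 _ (hy l i0 i0 i).2.2)).1
  refine hasCopy_F5Stss hm h3 a p q y ?_ hp hq ?_ hyn.1 hyn.2 ?_ ?_
  · intro i j hij
    simp only [ha] at hij
    split_ifs at hij with h1 h2 h2
    · have := hw (Subtype.ext hij)
      simp only [Fin.mk.injEq] at this
      exact Fin.ext this
    · exact absurd hij (hwx _ _)
    · exact absurd hij.symm (hwx _ _)
    · exact hx hij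
  · intro i
    simp only [ha]
    split_ifs with h1
    · exact (distinct_of_card_three (h3 _ (hy ⟨i, h1⟩ i0 i0 i0).2.2)).2.1
    · exact (distinct_of_card_three (h3 _ (hy l0 i0 i0 i).2.2)).2.2
  · intro i j k
    have rot : ∀ u : V, ({u, p j, q k} : Finset V) = {p j, q k, u} := by
      intro u; ext t; simp only [mem_insert, mem_singleton]; tauto
    simp only [ha]
    split_ifs with h1
    · rw [rot]; exact (hy _ k j i0).1
    · rw [rot]; exact (hy l0 k j i).2.1
  · intro i j hi hj _
    have e1 : a i = w ⟨i, hi⟩ := by simp [ha, hi]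
    have e2 : a j = x j := by simp [ha, hj]
    rw [e1, e2]
    have rot : ({y, (w ⟨i, hi⟩ : V), x j} : Finset V) = {(w ⟨i, hi⟩ : V), x j, y} := by
      ext t; simp only [mem_insert, mem_singleton]; tauto
    rw [rot]
    exact (hy _ i0 i0 j).2.2

/-- If `S_0`, `S_1` are completely joined in the link of `v` and the common link of
`S_0 ∪ S_1` is dense and extends, then there is a copy of `F_5^S(m, 1, K_{s,s})`. -/
lemma exists_hasCopy_of_dense_link (m s : ℕ) (hs : 2 ≤ s) (hm : 2 * s ≤ m) (c : ℝ) (hc : 0 < c) :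
    ∃ K : ℕ, ∀ (V : Type) [Fintype V] [DecidableEq V] (H : Finset (Finset V)) (v : V)
      (α β : Fin s → V), K ≤ Fintype.card V → (∀ e ∈ H, e.card = 3) →
      Function.Injective α → Function.Injective β →
      (∀ i j, ({v, α i, β j} : Finset V) ∈ H) →
      c * (Fintype.card V : ℝ) ^ 3 ≤ ∑ x, ∑ q, ∑ p,
        ind (({p, q, x} : Finset V) ∈ H ∧ (∀ i, ({p, q, α i} : Finset V) ∈ H) ∧
          (∀ i, ({p, q, β i} : Finset V) ∈ H) ∧ p ≠ v ∧ q ≠ v) →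
      HasCopy H (F5Stss m 1 s hm) := by
  set c1 := c ^ m / 2 with hc1
  set c2 := c1 ^ m / 2 with hc2
  have p1 : 0 < c1 := by positivity
  have p2 : 0 < c2 := by positivity
  obtain ⟨K, hK⟩ := exists_nat_gt
    (2 * (m : ℝ) ^ 2 / c ^ m + 2 * (m : ℝ) ^ 2 / c1 ^ m + (2 * m + 1) / c2)
  refine ⟨K, fun V _ _ H v α β hVK h3 hα hβ hαβ hcount => ?_⟩
  have n1 : 0 ≤ 2 * (m : ℝ) ^ 2 / c ^ m := by positivity
  have n2 : 0 ≤ 2 * (m : ℝ) ^ 2 / c1 ^ m := by positivity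
  have n5 : 0 ≤ (2 * m + 1) / c2 := by positivity
  have hVK' : (K : ℝ) ≤ Fintype.card V := by exact_mod_cast hVK
  have : Nonempty V := ⟨v⟩
  have big : ∀ {A B D : ℝ}, 0 < B → A / B < D → A < B * D := by
    intro A B D hB h; rwa [div_lt_iff₀ hB, mul_comm] at h
  obtain ⟨p, hp, hcp⟩ := exists_injective_tuple (X := V × V) (V := V)
    (fun z p => ({p, z.2, z.1} : Finset V) ∈ H ∧ (∀ i, ({p, z.2, α i} : Finset V) ∈ H) ∧
          (∀ i, ({p, z.2, β i} : Finset V) ∈ H) ∧ p ≠ v ∧ z.2 ≠ v) m hc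
    (big (by positivity) (by linarith))
    (by
      simp only [Fintype.sum_prod_type]
      convert hcount using 1
      simp; ring)
  rw [← hc1] at hcp
  obtain ⟨q, hq, hcq⟩ := exists_injective_tuple (X := V) (V := V)
    (fun z q => ∀ j, ({p j, q, z} : Finset V) ∈ H ∧ (∀ i, ({p j, q, α i} : Finset V) ∈ H) ∧
          (∀ i, ({p j, q, β i} : Finset V) ∈ H) ∧ p j ≠ v ∧ q ≠ v) m p1
    (big (by positivity) (by linarith))
    (by
      simp only [Fintype.sum_prod_type] at hcp ⊢
      convert hcp using 1
      simp; ring)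
  rw [← hc2, sum_ind_eq_card] at hcq
  set A := univ.filter (fun z => ∀ k j, ({p j, q k, z} : Finset V) ∈ H ∧
      (∀ i, ({p j, q k, α i} : Finset V) ∈ H) ∧
          (∀ i, ({p j, q k, β i} : Finset V) ∈ H) ∧ p j ≠ v ∧ q k ≠ v) with hA
  have hAcard : 2 * m + 1 < A.card := by
    have e2 : (2 * m + 1 : ℝ) < c2 * Fintype.card V := big p2 (by linarith)
    have e3 := e2.trans_le hcq
    exact (Nat.cast_lt (α := ℝ)).1 (by push_cast; exact e3)
  set B := A \ (univ.image α ∪ univ.image β ∪ {v}) with hB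
  have hBcard : m ≤ B.card := by
    have e1 : (univ.image α ∪ univ.image β ∪ {v}).card ≤ 2 * s + 1 := by
      refine (card_union_le _ _).trans ?_
      have := card_union_le (univ.image α) (univ.image β)
      have := card_image_le (s := univ) (f := α)
      have := card_image_le (s := univ) (f := β)
      simp only [card_univ, Fintype.card_fin, card_singleton] at *
      omega
    have := le_card_sdiff (univ.image α ∪ univ.image β ∪ {v}) A
    rw [← hB] at this
    omega
  obtain ⟨x, hx, hxB⟩ : ∃ x : Fin m → V, Function.Injective x ∧ ∀ i, x i ∈ B := by
    obtain ⟨B', hB', hcard⟩ := exists_subset_card_eq hBcard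
    exact ⟨fun i => (B'.equivFinOfCardEq hcard).symm i,
      fun i j h => (B'.equivFinOfCardEq hcard).symm.injective (Subtype.ext h),
      fun i => hB' ((B'.equivFinOfCardEq hcard).symm i).2⟩
  have hxA : ∀ i, (∀ k j, ({p j, q k, x i} : Finset V) ∈ H ∧
      (∀ i, ({p j, q k, α i} : Finset V) ∈ H) ∧
          (∀ i, ({p j, q k, β i} : Finset V) ∈ H) ∧ p j ≠ v ∧ q k ≠ v) ∧
      (∀ l, α l ≠ x i) ∧ (∀ l, β l ≠ x i) ∧ x i ≠ v := by
    intro i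
    have := hxB i
    simp only [hB, hA, mem_sdiff, mem_filter, mem_univ, true_and, mem_union, mem_image,
      mem_singleton, not_or, not_exists] at this
    tauto
  have i0 : Fin m := ⟨0, by omega⟩
  have l0 : Fin s := ⟨0, by omega⟩
  have hd : ∀ i j, α i ≠ β j := fun i j => (distinct_of_card_three (h3 _ (hαβ i j))).2.2
  set a : Fin m → V := fun i => if h : (i : ℕ) < s then α ⟨i, h⟩ else
    if h' : (i : ℕ) - s < s then β ⟨i - s, h'⟩ else x i with ha
  refine hasCopy_F5Stss hm h3 a p q v ?_ hp hq ?_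
    (fun j => ((hxA i0).1 i0 j).2.2.2.1) (fun k => ((hxA i0).1 k i0).2.2.2.2) ?_ ?_
  · intro i j hij
    simp only [ha] at hij
    split_ifs at hij with h1 h2 h2 h3 h4 h5 h6 h7
    · have := hα hij; simp only [Fin.mk.injEq] at this; exact Fin.ext this
    · exact absurd hij (hd _ _)
    · exact absurd hij ((hxA _).2.1 _)
    · exact absurd hij.symm (hd _ _)
    · have := hβ hij; simp only [Fin.mk.injEq] at this; ext; omega
    · exact absurd hij ((hxA _).2.2.1 _)
    · exact absurd hij.symm ((hxA _).2.1 _)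
    · exact absurd hij.symm ((hxA _).2.2.1 _)
    · exact hx hij
  · intro i
    simp only [ha]
    split_ifs with h1 h2
    · exact (distinct_of_card_three (h3 _ (hαβ ⟨i, h1⟩ l0))).1.symm
    · exact (distinct_of_card_three (h3 _ (hαβ l0 ⟨i - s, h2⟩))).2.1.symm
    · exact (hxA _).2.2.2
  · intro i j k
    have rot : ∀ u : V, ({u, p j, q k} : Finset V) = {p j, q k, u} := by
      intro u; ext t; simp only [mem_insert, mem_singleton]; tauto
    simp only [ha]
    rw [rot]
    split_ifs with h1 h2
    · exact ((hxA i0).1 k j).2.1 _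
    · exact ((hxA i0).1 k j).2.2.1 _
    · exact ((hxA i).1 k j).1
  · intro i j hi hj hj2
    have e1 : a i = α ⟨i, hi⟩ := by simp [ha, hi]
    have e2 : a j = β ⟨j - s, by omega⟩ := by
      simp only [ha]; rw [dif_neg (by omega), dif_pos (by omega)]
    rw [e1, e2]
    exact hαβ _ _

lemma sum_rotate {V : Type*} [Fintype V] (F : V → V → V → ℝ) :
    ∑ a, ∑ b, ∑ c, F b c a = ∑ a, ∑ b, ∑ c, F a b c := by
  calc ∑ a, ∑ b, ∑ c, F b c a = ∑ b, ∑ a, ∑ c, F b c a := sum_comm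
    _ = ∑ b, ∑ c, ∑ a, F b c a := sum_congr rfl fun b _ => sum_comm

/-- The three colours `χ a`, `χ b`, `χ c` are distinct. -/
def Rainbow {V : Type*} (χ : V → Fin 3) (a b c : V) : Prop := χ a ≠ χ b ∧ χ a ≠ χ c ∧ χ b ≠ χ c

section Stability

variable {V : Type*} [Fintype V] (e : V → V → V → Prop)

/-- Codegree of the pair `x`, `y`. -/
noncomputable def codeg (x y : V) : ℝ := ∑ z, ind (e x y z)

/-- Indicator of the pairs of codegree at least `r`. -/
noncomputable def heavy (r : ℝ) (x y : V) : ℝ := ind (r ≤ codeg e x y)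

lemma codeg_nonneg (x y : V) : 0 ≤ codeg e x y := sum_nonneg fun _ _ => ind_nonneg _

lemma codeg_le (x y : V) : codeg e x y ≤ Fintype.card V := by
  unfold codeg
  calc ∑ z, ind (e x y z) ≤ ∑ _z : V, (1 : ℝ) := sum_le_sum fun z _ => ind_le_one _
    _ = Fintype.card V := by simp

lemma heavy_mul_le (r : ℝ) (x y : V) : r * heavy e r x y ≤ codeg e x y := by
  unfold heavy
  by_cases h : r ≤ codeg e x y
  · rw [ind_of h]; linarith
  · rw [ind_of_not h]; linarith [codeg_nonneg e x y]

lemma one_sub_heavy_mul_codeg_le {r : ℝ} (hr : 0 ≤ r) (x y : V) :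
    (1 - heavy e r x y) * codeg e x y ≤ r := by
  unfold heavy
  by_cases h : r ≤ codeg e x y
  · rw [ind_of h]; linarith
  · rw [ind_of_not h]; linarith

variable {e}

omit [Fintype V] in
lemma ind_rotate (h1 : ∀ a b c, e a b c → e b a c) (h2 : ∀ a b c, e a b c → e a c b)
    (a b c : V) : ind (e a b c) = ind (e b c a) :=
  ind_congr ⟨fun h => h2 _ _ _ (h1 _ _ _ h), fun h => h1 _ _ _ (h2 _ _ _ h)⟩

/-- Few copies of `F_5` give few pairs of heavy pairs inside common neighbourhoods. -/
lemma sum_heavy_le {τ : ℝ} (hτ : 0 < τ) [Nonempty V]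
    (hQ : ∑ p, ∑ q, ∑ w, ∑ x, ∑ y, ind (e p q w) * ind (e p q x) * ind (e w x y)
      ≤ τ ^ 2 * (Fintype.card V : ℝ) ^ 5) :
    ∑ p, ∑ q, ∑ w, ∑ x, ind (e p q w) * ind (e p q x) * heavy e (τ * Fintype.card V) w x
      ≤ τ * (Fintype.card V : ℝ) ^ 4 := by
  have hn : (0 : ℝ) < Fintype.card V := by exact_mod_cast Fintype.card_pos
  refine le_of_mul_le_mul_left ?_ (mul_pos hτ hn)
  calc τ * Fintype.card V *
      ∑ p, ∑ q, ∑ w, ∑ x, ind (e p q w) * ind (e p q x) * heavy e (τ * Fintype.card V) w x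
      ≤ ∑ p, ∑ q, ∑ w, ∑ x, ∑ y, ind (e p q w) * ind (e p q x) * ind (e w x y) := by
        simp only [mul_sum]
        refine sum_le_sum fun p _ => sum_le_sum fun q _ => sum_le_sum fun w _ =>
          sum_le_sum fun x _ => ?_
        rw [← mul_sum]
        have := heavy_mul_le e (τ * Fintype.card V) w x
        calc _ = ind (e p q w) * ind (e p q x) *
              (τ * Fintype.card V * heavy e (τ * Fintype.card V) w x) := by ring
          _ ≤ _ := mul_le_mul_of_nonneg_left this (mul_nonneg (ind_nonneg _) (ind_nonneg _))
    _ ≤ _ := hQ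
    _ = _ := by ring

lemma sum_deg_mul_heavyDeg_le (h1 : ∀ a b c, e a b c → e b a c) (h2 : ∀ a b c, e a b c → e a c b)
    (r : ℝ) :
    ∑ x, (∑ b, codeg e x b) * (∑ b, heavy e r x b) + ∑ x, ∑ b, codeg e x b ^ 2
      ≤ Fintype.card V * (∑ a, ∑ b, codeg e a b)
        + ∑ p, ∑ q, ∑ w, ∑ x, ind (e p q w) * ind (e p q x) * heavy e r w x := by
  have key : ∀ p q w, ind (e p q w) * (∑ x, heavy e r w x) + ind (e p q w) * codeg e p q
      ≤ Fintype.card V * ind (e p q w)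
        + ∑ x, ind (e p q w) * ind (e p q x) * heavy e r w x := by
    intro p q w
    have : ∀ x, ind (e p q w) * heavy e r w x + ind (e p q w) * ind (e p q x)
        ≤ ind (e p q w) + ind (e p q w) * ind (e p q x) * heavy e r w x := by
      intro x
      have a1 := ind_nonneg (e p q w)
      have a2 := ind_le_one (e p q x)
      have a3 : heavy e r w x ≤ 1 := ind_le_one _
      have a4 := mul_nonneg a1 (mul_nonneg (sub_nonneg.2 a2) (sub_nonneg.2 a3))
      nlinarith
    have := sum_le_sum fun x (_ : x ∈ (univ : Finset V)) => this x
    rw [sum_add_distrib, sum_add_distrib, ← mul_sum, ← mul_sum] at this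
    simpa [codeg, nsmul_eq_mul] using this
  have hsum := sum_le_sum fun p (_ : p ∈ (univ : Finset V)) =>
    sum_le_sum fun q (_ : q ∈ (univ : Finset V)) =>
      sum_le_sum fun w (_ : w ∈ (univ : Finset V)) => key p q w
  simp only [sum_add_distrib] at hsum
  have e1 : ∑ p, ∑ q, ∑ w, ind (e p q w) * (∑ x, heavy e r w x)
      = ∑ x, (∑ b, codeg e x b) * (∑ b, heavy e r x b) := by
    rw [← sum_rotate]
    simp only [codeg, sum_mul]
    refine sum_congr rfl fun a _ => sum_congr rfl fun b _ => sum_congr rfl fun c _ => ?_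
    rw [ind_rotate h1 h2 a b c]
  have e2 : ∑ p, ∑ q, ∑ w, ind (e p q w) * codeg e p q = ∑ x, ∑ b, codeg e x b ^ 2 := by
    refine sum_congr rfl fun a _ => sum_congr rfl fun b _ => ?_
    rw [← sum_mul, sq]; rfl
  have e3 : ∑ p, ∑ q, ∑ w, (Fintype.card V : ℝ) * ind (e p q w)
      = Fintype.card V * (∑ a, ∑ b, codeg e a b) := by
    simp only [mul_sum, codeg]
  rw [e1, e2, e3] at hsum
  exact hsum

lemma deg_mul_heavyDeg_ge {τ : ℝ} (hτ : 0 < τ) (x : V) :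
    2 * Fintype.card V * (∑ b, codeg e x b) - 4 / 27 * (Fintype.card V : ℝ) ^ 3
        - 4 * τ * (Fintype.card V : ℝ) ^ 3
      ≤ (∑ b, codeg e x b) * (∑ b, heavy e (τ * Fintype.card V) x b)
        + 2 * ∑ b, codeg e x b ^ 2 := by
  set n : ℝ := (Fintype.card V : ℝ) with hn
  have hn0 : 0 ≤ n := Nat.cast_nonneg _
  set d := ∑ b, codeg e x b with hd
  set D := ∑ b, heavy e (τ * n) x b with hD
  have hd0 : 0 ≤ d := sum_nonneg fun b _ => codeg_nonneg e x b
  have hdn : d ≤ n ^ 2 := by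
    calc d ≤ ∑ _b : V, n := sum_le_sum fun b _ => codeg_le e x b
      _ = n ^ 2 := by simp [hn]; ring
  set l := Real.sqrt (d / 2) with hl
  have hl0 : 0 ≤ l := Real.sqrt_nonneg _
  have hl2 : l ^ 2 = d / 2 := Real.sq_sqrt (by positivity)
  have hln : l ≤ n := by
    apply Real.sqrt_le_iff.2 ⟨hn0, by linarith⟩
  have hS : 2 * l * (d - τ * n ^ 2) - l ^ 2 * D ≤ ∑ b, codeg e x b ^ 2 := by
    have : ∀ b, 2 * l * (codeg e x b - τ * n) - l ^ 2 * heavy e (τ * n) x b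
        ≤ codeg e x b ^ 2 := by
      intro b
      have h3 := one_sub_heavy_mul_codeg_le e (mul_nonneg hτ.le hn0) x b
      have h4 := codeg_nonneg e x b
      unfold heavy at h3 ⊢
      by_cases h : τ * n ≤ codeg e x b
      · rw [ind_of h]
        nlinarith [sq_nonneg (codeg e x b - l), mul_nonneg hl0 (mul_nonneg hτ.le hn0)]
      · rw [ind_of_not h] at h3 ⊢
        nlinarith [mul_nonneg hl0 (sub_nonneg.2 h3), sq_nonneg (codeg e x b)]
    have hsum := sum_le_sum fun b (_ : b ∈ (univ : Finset V)) => this b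
    rw [sum_sub_distrib, ← mul_sum, ← mul_sum, sum_sub_distrib] at hsum
    simp only [sum_const, card_univ, nsmul_eq_mul, ← hn] at hsum
    rw [show 2 * l * (d - τ * n ^ 2) = 2 * l * (d - n * (τ * n)) by ring]
    exact hsum
  have h5 : 8 * l ^ 3 ≥ 4 * n * l ^ 2 - 4 / 27 * n ^ 3 := by
    nlinarith [mul_nonneg (sq_nonneg (l - n / 3)) (show (0 : ℝ) ≤ 2 * l + n / 3 by positivity)]
  have h6 : l * (τ * n ^ 2) ≤ n * (τ * n ^ 2) :=
    mul_le_mul_of_nonneg_right hln (by positivity)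
  have hdl : d = 2 * l ^ 2 := by linarith
  rw [hdl] at hS ⊢
  nlinarith

lemma sum_overlap_le (h1 : ∀ a b c, e a b c → e b a c) (h2 : ∀ a b c, e a b c → e a c b)
    {r : ℝ} (hr : 0 ≤ r) :
    ∑ a, ∑ b, ∑ c, ∑ y, ind (e a b c) * (ind (e a b y) * ind (e b c y))
      ≤ ∑ p, ∑ q, ∑ w, ∑ x, ind (e p q w) * ind (e p q x) * heavy e r w x
        + r * (Fintype.card V : ℝ) ^ 3 := by
  have key : ∀ a b c y, ind (e a b c) * (ind (e a b y) * ind (e b c y))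
      ≤ ind (e a b c) * ind (e a b y) * heavy e r c y
        + (1 - heavy e r c y) * ind (e c y b) := by
    intro a b c y
    rw [ind_rotate h1 h2 b c y]
    have a1 := ind_nonneg (e a b c)
    have a2 := ind_nonneg (e a b y)
    have a3 := ind_nonneg (e c y b)
    have a4 : 0 ≤ 1 - heavy e r c y := sub_nonneg.2 (ind_le_one _)
    have a4' : 0 ≤ heavy e r c y := ind_nonneg _
    have b1 := ind_le_one (e a b c)
    have b2 := ind_le_one (e a b y)
    have b3 := ind_le_one (e c y b)
    have c1 : ind (e a b c) * ind (e a b y) ≤ 1 := mul_le_one₀ b1 a2 b2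
    have c0 : 0 ≤ ind (e a b c) * ind (e a b y) := mul_nonneg a1 a2
    calc _ = ind (e a b c) * ind (e a b y) * (heavy e r c y * ind (e c y b))
          + ind (e a b c) * ind (e a b y) * ((1 - heavy e r c y) * ind (e c y b)) := by ring
      _ ≤ ind (e a b c) * ind (e a b y) * (heavy e r c y * 1)
          + 1 * ((1 - heavy e r c y) * ind (e c y b)) := by gcongr
      _ = _ := by ring
  have hsum := sum_le_sum fun a (_ : a ∈ (univ : Finset V)) =>
    sum_le_sum fun b (_ : b ∈ (univ : Finset V)) =>
      sum_le_sum fun c (_ : c ∈ (univ : Finset V)) =>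
        sum_le_sum fun y (_ : y ∈ (univ : Finset V)) => key a b c y
  simp only [sum_add_distrib] at hsum
  refine hsum.trans (add_le_add le_rfl ?_)
  rw [sum_const, card_univ, nsmul_eq_mul]
  have : ∑ b, ∑ c, ∑ y, (1 - heavy e r c y) * ind (e c y b)
      = ∑ c, ∑ y, (1 - heavy e r c y) * codeg e c y := by
    rw [sum_rotate (fun c y b => (1 - heavy e r c y) * ind (e c y b))]
    simp only [codeg, mul_sum]
  rw [this]
  calc (Fintype.card V : ℝ) * ∑ c, ∑ y, (1 - heavy e r c y) * codeg e c y
      ≤ (Fintype.card V : ℝ) * ∑ _c : V, ∑ _y : V, r := by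
        gcongr with c _ y _
        exact one_sub_heavy_mul_codeg_le e hr c y
    _ = _ := by simp; ring



/-- The vertices missed by all three links of an edge. -/
noncomputable def missed (e : V → V → V → Prop) (a b c y : V) : ℝ :=
  (1 - ind (e a b y)) * (1 - ind (e b c y)) * (1 - ind (e c a y))

/-- The number of heavy pairs in the common neighbourhood of `a` and `b`. -/
noncomputable def heavyIn (e : V → V → V → Prop) (r : ℝ) (a b : V) : ℝ :=
  ∑ x, ∑ y, ind (e a b x) * ind (e a b y) * heavy e r x y

lemma heavyIn_nonneg (r : ℝ) (a b : V) : 0 ≤ heavyIn e r a b :=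
  sum_nonneg fun _ _ => sum_nonneg fun _ _ =>
    mul_nonneg (mul_nonneg (ind_nonneg _) (ind_nonneg _)) (ind_nonneg _)

lemma sum_missed_le (h1 : ∀ a b c, e a b c → e b a c) (h2 : ∀ a b c, e a b c → e a c b)
    [Nonempty V] {τ : ℝ} (hτ : 0 < τ)
    (hQ : ∑ p, ∑ q, ∑ w, ∑ x, ∑ y, ind (e p q w) * ind (e p q x) * ind (e w x y)
      ≤ τ ^ 2 * (Fintype.card V : ℝ) ^ 5)
    (hT : 2 / 9 * (Fintype.card V : ℝ) ^ 3 ≤ ∑ a, ∑ b, ∑ c, ind (e a b c)) :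
    ∑ a, ∑ b, ∑ c, ind (e a b c) * ∑ y, missed e a b c y ≤ 21 * τ * (Fintype.card V : ℝ) ^ 4 := by
  have hB := sum_heavy_le hτ hQ
  have hD := sum_deg_mul_heavyDeg_le h1 h2 (τ * Fintype.card V)
  have hO := sum_overlap_le h1 h2 (r := τ * Fintype.card V) (by positivity)
  have hx := sum_le_sum fun x (_ : x ∈ (univ : Finset V)) => deg_mul_heavyDeg_ge (e := e) hτ x
  simp only [sum_add_distrib, sum_sub_distrib, ← mul_sum, sum_const, card_univ,
    nsmul_eq_mul] at hx
  have key : ∀ a b c, ind (e a b c) * ∑ y, missed e a b c y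
      ≤ Fintype.card V * ind (e a b c)
        - (ind (e a b c) * codeg e a b + ind (e b c a) * codeg e b c
          + ind (e c a b) * codeg e c a)
        + (∑ y, ind (e a b c) * (ind (e a b y) * ind (e b c y))
          + ∑ y, ind (e b c a) * (ind (e b c y) * ind (e c a y))
          + ∑ y, ind (e c a b) * (ind (e c a y) * ind (e a b y))) := by
    intro a b c
    rw [← ind_rotate h1 h2 b c a, ← ind_rotate h1 h2 a b c]
    simp only [← mul_sum, codeg]
    rw [mul_comm (Fintype.card V : ℝ), ← mul_add, ← mul_add, ← mul_add, ← mul_add, ← mul_sub,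
      ← mul_add]
    refine mul_le_mul_of_nonneg_left ?_ (ind_nonneg _)
    have : (Fintype.card V : ℝ) = ∑ _y : V, 1 := by simp
    rw [this]
    simp only [← sum_add_distrib, ← sum_sub_distrib]
    refine sum_le_sum fun y _ => ?_
    unfold missed
    have := mul_nonneg (mul_nonneg (ind_nonneg (e a b y)) (ind_nonneg (e b c y)))
      (ind_nonneg (e c a y))
    nlinarith
  have hsum := sum_le_sum fun a (_ : a ∈ (univ : Finset V)) =>
    sum_le_sum fun b (_ : b ∈ (univ : Finset V)) =>
      sum_le_sum fun c (_ : c ∈ (univ : Finset V)) => key a b c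
  simp only [sum_add_distrib, sum_sub_distrib] at hsum
  rw [sum_rotate fun a b c => ind (e a b c) * codeg e a b,
    sum_rotate fun a b c => ∑ y, ind (e a b c) * (ind (e a b y) * ind (e b c y)),
    ← sum_rotate fun a b c => ind (e c a b) * codeg e c a,
    ← sum_rotate fun a b c => ∑ y, ind (e c a b) * (ind (e c a y) * ind (e a b y))] at hsum
  have hS : ∑ a, ∑ b, ∑ c, ind (e a b c) * codeg e a b = ∑ x, ∑ b, codeg e x b ^ 2 := by
    refine sum_congr rfl fun a _ => sum_congr rfl fun b _ => ?_
    rw [← sum_mul, sq]; rfl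
  rw [hS] at hsum
  have hT' : ∑ a, ∑ b, ∑ c, (Fintype.card V : ℝ) * ind (e a b c)
      = Fintype.card V * ∑ a, ∑ b, codeg e a b := by
    simp only [mul_sum, codeg]
  rw [hT'] at hsum
  have hT2 : 2 / 9 * (Fintype.card V : ℝ) ^ 4
      ≤ Fintype.card V * ∑ a, ∑ b, codeg e a b := by
    calc 2 / 9 * (Fintype.card V : ℝ) ^ 4
        = Fintype.card V * (2 / 9 * (Fintype.card V : ℝ) ^ 3) := by ring
      _ ≤ _ := by gcongr; exact hT
  rw [show (Fintype.card V : ℝ) * (Fintype.card V : ℝ) ^ 3 = (Fintype.card V : ℝ) ^ 4 by ring]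
    at hx
  rw [show τ * Fintype.card V * (Fintype.card V : ℝ) ^ 3 = τ * (Fintype.card V : ℝ) ^ 4 by ring]
    at hO
  nlinarith

lemma sum_heavyIn_le [Nonempty V] (r : ℝ) :
    ∑ a, ∑ b, ∑ c, ind (e a b c) * heavyIn e r a b
      ≤ Fintype.card V *
        ∑ p, ∑ q, ∑ w, ∑ x, ind (e p q w) * ind (e p q x) * heavy e r w x := by
  rw [mul_sum]
  refine sum_le_sum fun a _ => ?_
  rw [mul_sum]
  refine sum_le_sum fun b _ => ?_
  calc ∑ c, ind (e a b c) * heavyIn e r a b ≤ ∑ _c : V, heavyIn e r a b :=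
        sum_le_sum fun c _ => mul_le_of_le_one_left (heavyIn_nonneg _ _ _) (ind_le_one _)
    _ = _ := by rw [sum_const, card_univ, nsmul_eq_mul]; rfl

/-- Some edge has links covering almost everything, each containing few heavy pairs. -/
lemma exists_good_edge (h1 : ∀ a b c, e a b c → e b a c) (h2 : ∀ a b c, e a b c → e a c b)
    [Nonempty V] {τ : ℝ} (hτ : 0 < τ)
    (hQ : ∑ p, ∑ q, ∑ w, ∑ x, ∑ y, ind (e p q w) * ind (e p q x) * ind (e w x y)
      ≤ τ ^ 2 * (Fintype.card V : ℝ) ^ 5)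
    (hT : 2 / 9 * (Fintype.card V : ℝ) ^ 3 ≤ ∑ a, ∑ b, ∑ c, ind (e a b c)) :
    ∃ a b c, Fintype.card V * ∑ y, missed e a b c y + heavyIn e (τ * Fintype.card V) a b
      + heavyIn e (τ * Fintype.card V) b c + heavyIn e (τ * Fintype.card V) c a
      ≤ 200 * τ * (Fintype.card V : ℝ) ^ 2 := by
  by_contra! hno
  have hn : (0 : ℝ) < Fintype.card V := by exact_mod_cast Fintype.card_pos
  have hm := sum_missed_le h1 h2 hτ hQ hT
  have hI := (sum_heavyIn_le (e := e) (τ * Fintype.card V)).trans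
    (mul_le_mul_of_nonneg_left (sum_heavy_le hτ hQ) hn.le)
  have key : ∀ a b c, 200 * τ * (Fintype.card V : ℝ) ^ 2 * ind (e a b c)
      ≤ Fintype.card V * (ind (e a b c) * ∑ y, missed e a b c y)
        + ind (e a b c) * heavyIn e (τ * Fintype.card V) a b
        + ind (e b c a) * heavyIn e (τ * Fintype.card V) b c
        + ind (e c a b) * heavyIn e (τ * Fintype.card V) c a := by
    intro a b c
    rw [← ind_rotate h1 h2 b c a, ← ind_rotate h1 h2 a b c]
    have := mul_le_mul_of_nonneg_left (hno a b c).le (ind_nonneg (e a b c))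
    linarith
  have hsum := sum_le_sum fun a (_ : a ∈ (univ : Finset V)) =>
    sum_le_sum fun b (_ : b ∈ (univ : Finset V)) =>
      sum_le_sum fun c (_ : c ∈ (univ : Finset V)) => key a b c
  simp only [sum_add_distrib] at hsum
  rw [sum_rotate fun a b c => ind (e a b c) * heavyIn e (τ * Fintype.card V) a b,
    ← sum_rotate fun a b c => ind (e c a b) * heavyIn e (τ * Fintype.card V) c a] at hsum
  simp only [← mul_sum] at hsum
  have a1 := mul_le_mul_of_nonneg_left hT
    (show 0 ≤ 200 * τ * (Fintype.card V : ℝ) ^ 2 by positivity)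
  have a2 := mul_le_mul_of_nonneg_left hm hn.le
  have a3 : 0 < τ * (Fintype.card V : ℝ) ^ 5 := by positivity
  nlinarith

lemma sum_mono_codeg_le (h1 : ∀ a b c, e a b c → e b a c) (h2 : ∀ a b c, e a b c → e a c b)
    (χ : V → Fin 3) :
    ∑ a, ∑ b, ∑ c, ind (e a b c ∧ ¬ Rainbow χ a b c)
      ≤ 3 * ∑ x, ∑ y, codeg e x y * ind (χ x = χ y) := by
  have key : ∀ a b c, ind (e a b c ∧ ¬ Rainbow χ a b c)
      ≤ ind (e a b c) * ind (χ a = χ b) + ind (e b c a) * ind (χ b = χ c)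
        + ind (e c a b) * ind (χ c = χ a) := by
    intro a b c
    rw [← ind_rotate h1 h2 b c a, ← ind_rotate h1 h2 a b c, ← mul_add, ← mul_add, ind_and]
    refine mul_le_mul_of_nonneg_left ?_ (ind_nonneg _)
    calc ind (¬ Rainbow χ a b c) ≤ ind ((χ a = χ b ∨ χ b = χ c) ∨ χ c = χ a) :=
          ind_mono fun h => by unfold Rainbow at h; grind
      _ ≤ _ := (ind_or_le _ _).trans (add_le_add_left (ind_or_le _ _) _)
  have hsum := sum_le_sum fun a (_ : a ∈ (univ : Finset V)) =>
    sum_le_sum fun b (_ : b ∈ (univ : Finset V)) =>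
      sum_le_sum fun c (_ : c ∈ (univ : Finset V)) => key a b c
  simp only [sum_add_distrib] at hsum
  rw [sum_rotate fun a b c => ind (e a b c) * ind (χ a = χ b),
    ← sum_rotate fun a b c => ind (e c a b) * ind (χ c = χ a)] at hsum
  simp only [codeg, sum_mul]
  linarith

end Stability

/-- Stability: a dense 3-graph with few copies of `F_5` is nearly tripartite. -/
theorem stability {δ : ℝ} (hδ : 0 < δ) : ∃ κ > 0, ∀ (V : Type) [Fintype V] [Nonempty V]
    (e : V → V → V → Prop), (∀ a b c, e a b c → e b a c) → (∀ a b c, e a b c → e a c b) →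
    ∑ p, ∑ q, ∑ w, ∑ x, ∑ y, ind (e p q w) * ind (e p q x) * ind (e w x y)
      ≤ κ * (Fintype.card V : ℝ) ^ 5 →
    2 / 9 * (Fintype.card V : ℝ) ^ 3 ≤ ∑ a, ∑ b, ∑ c, ind (e a b c) →
    ∃ χ : V → Fin 3, ∑ a, ∑ b, ∑ c, ind (e a b c ∧ ¬ Rainbow χ a b c)
      ≤ δ * (Fintype.card V : ℝ) ^ 3 := by
  classical
  set τ := δ / 1300 with hτd
  have hτ : 0 < τ := by positivity
  refine ⟨τ ^ 2, by positivity, fun V _ _ e h1 h2 hQ hT => ?_⟩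
  have hn : (0 : ℝ) < Fintype.card V := by exact_mod_cast Fintype.card_pos
  obtain ⟨a, b, c, habc⟩ := exists_good_edge h1 h2 hτ hQ hT
  set n : ℝ := (Fintype.card V : ℝ) with hnd
  let χ : V → Fin 3 := fun y => if e a b y then 0 else if e b c y then 1 else 2
  refine ⟨χ, (sum_mono_codeg_le h1 h2 χ).trans ?_⟩
  have key : ∀ x y, codeg e x y * ind (χ x = χ y)
      ≤ τ * n + n * (ind (e a b x) * ind (e a b y) * heavy e (τ * n) x y
        + ind (e b c x) * ind (e b c y) * heavy e (τ * n) x y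
        + ind (e c a x) * ind (e c a y) * heavy e (τ * n) x y
        + missed e a b c x + missed e a b c y) := by
    intro x y
    have b1 : codeg e x y ≤ τ * n + n * heavy e (τ * n) x y := by
      have := one_sub_heavy_mul_codeg_le e (mul_nonneg hτ.le hn.le) x y
      have h3 := mul_le_mul_of_nonneg_right (codeg_le e x y) (ind_nonneg (τ * n ≤ codeg e x y))
      unfold heavy at this ⊢
      linarith
    have hh0 : 0 ≤ heavy e (τ * n) x y := ind_nonneg _
    have hh1 : heavy e (τ * n) x y ≤ 1 := ind_le_one _
    have b2 : heavy e (τ * n) x y * ind (χ x = χ y)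
        ≤ ind (e a b x) * ind (e a b y) * heavy e (τ * n) x y
        + ind (e b c x) * ind (e b c y) * heavy e (τ * n) x y
        + ind (e c a x) * ind (e c a y) * heavy e (τ * n) x y
        + missed e a b c x + missed e a b c y := by
      simp only [χ, missed]
      by_cases x1 : e a b x <;> by_cases x2 : e b c x <;> by_cases x3 : e c a x <;>
        by_cases y1 : e a b y <;> by_cases y2 : e b c y <;> by_cases y3 : e c a y <;>
        simp [x1, x2, x3, y1, y2, y3, ind] <;> linarith
    calc codeg e x y * ind (χ x = χ y)
        ≤ (τ * n + n * heavy e (τ * n) x y) * ind (χ x = χ y) :=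
          mul_le_mul_of_nonneg_right b1 (ind_nonneg _)
      _ = τ * n * ind (χ x = χ y) + n * (heavy e (τ * n) x y * ind (χ x = χ y)) := by ring
      _ ≤ _ := by
          have := mul_le_mul_of_nonneg_left b2 hn.le
          have := mul_le_mul_of_nonneg_left (ind_le_one (χ x = χ y)) (mul_nonneg hτ.le hn.le)
          linarith
  have hsum := sum_le_sum fun x (_ : x ∈ (univ : Finset V)) =>
    sum_le_sum fun y (_ : y ∈ (univ : Finset V)) => key x y
  simp only [sum_add_distrib, mul_add, ← mul_sum, sum_const, card_univ, nsmul_eq_mul,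
    ← hnd] at hsum
  have d1 : 0 ≤ heavyIn e (τ * n) a b := heavyIn_nonneg _ _ _
  have d2 : 0 ≤ heavyIn e (τ * n) b c := heavyIn_nonneg _ _ _
  have d3 : 0 ≤ heavyIn e (τ * n) c a := heavyIn_nonneg _ _ _
  simp only [heavyIn] at habc d1 d2 d3
  have := mul_le_mul_of_nonneg_left habc (show 0 ≤ 6 * n by positivity)
  have hτn : 0 < τ * n ^ 3 := by positivity
  have hδτ : δ = 1300 * τ := by rw [hτd]; ring
  rw [hδτ]
  nlinarith [mul_nonneg hn.le d1, mul_nonneg hn.le d2, mul_nonneg hn.le d3]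

/-- `A` contains no complete bipartite graph `K_{s,s}` (given by two injective tuples). -/
def KssFree {V : Type*} (s : ℕ) (A : V → V → Prop) : Prop :=
  ∀ α β : Fin s → V, Function.Injective α → Function.Injective β → ¬ ∀ i j, A (α i) (β j)

/-- The Kővári–Sós–Turán theorem for the pairs with first vertex in `R`. -/
lemma KssFree.pow_sum_le {V : Type*} [Fintype V] {s : ℕ} (hs : 2 ≤ s) {A : V → V → Prop}
    (hA : KssFree s A) (R : Finset V) :
    (∑ x ∈ R, ∑ y, ind (A x y)) ^ s
      ≤ 2 * (s : ℝ) ^ 2 * (Fintype.card V : ℝ) ^ s * (R.card : ℝ) ^ (s - 1) := by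
  classical
  obtain ⟨k, rfl⟩ : ∃ k, s = k + 1 := ⟨s - 1, by omega⟩
  set s := k + 1 with hsd
  rcases R.eq_empty_or_nonempty with rfl | hR
  · simp [hsd]; positivity
  obtain ⟨v0, hv0⟩ := hR
  have hRp : (0 : ℝ) < R.card := by exact_mod_cast card_pos.2 ⟨v0, hv0⟩
  have hnp : (0 : ℝ) < Fintype.card V := by exact_mod_cast Fintype.card_pos_iff.2 ⟨v0⟩
  have hRn : (R.card : ℝ) ≤ Fintype.card V := by exact_mod_cast card_le_univ R
  have hs1 : (1 : ℝ) ≤ s := by exact_mod_cast (by omega : 1 ≤ s)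
  have h1 := pow_sum_div_card_le_sum_pow (s := (univ : Finset V))
    (f := fun y => ∑ x : R, ind (A x y)) (n := k) (fun y _ => sum_nonneg fun v _ => ind_nonneg _)
  have h2 := sum_tuples_eq (fun (y : V) (x : R) => A x y) s
  have h3 : ∀ g : Fin s → R, ∑ y, ind (∀ i, A (g i) y)
      ≤ s + Fintype.card V * ind (¬ Function.Injective g) := by
    intro g
    by_cases hg : Function.Injective g
    · rw [ind_of_not (not_not.2 hg), mul_zero, add_zero, sum_ind_eq_card]
      by_contra! hlt
      have hlt : s ≤ (univ.filter fun y => ∀ i, A (g i) y).card := by exact_mod_cast hlt.le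
      obtain ⟨t, ht, htc⟩ := exists_subset_card_eq hlt
      let β : Fin s → V := fun i => t.equivFin.symm (Fin.cast htc.symm i)
      refine hA (fun i => g i) β (Subtype.val_injective.comp hg) ?_ fun i j => ?_
      · intro i j hij
        have := t.equivFin.symm.injective (Subtype.val_injective hij)
        exact Fin.cast_injective _ this
      · have := ht (t.equivFin.symm (Fin.cast htc.symm j)).2
        exact (mem_filter.1 this).2 i
    · rw [ind_of hg, mul_one]
      have : ∑ y, ind (∀ i, A (g i) y) ≤ ∑ _y : V, 1 := sum_le_sum fun y _ => ind_le_one _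
      simp only [sum_const, card_univ, nsmul_eq_mul, mul_one] at this
      linarith
  have h4 := sum_le_sum fun g (_ : g ∈ (univ : Finset (Fin s → R))) => h3 g
  rw [sum_add_distrib, ← mul_sum, h2] at h4
  simp only [sum_const, card_univ, nsmul_eq_mul, Fintype.card_fun, Fintype.card_fin,
    Nat.cast_pow, Fintype.card_coe] at h4
  have h5 := sum_not_injective_le s R
  rw [Fintype.card_coe] at h5
  rw [div_le_iff₀ (by rw [card_univ]; positivity), card_univ] at h1
  have h6 : ∑ y, ∑ x : R, ind (A x y) = ∑ x ∈ R, ∑ y, ind (A x y) := by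
    rw [sum_comm, ← sum_coe_sort R fun x => ∑ y, ind (A x y)]
  rw [h6] at h1
  set Z := ∑ x ∈ R, ∑ y, ind (A x y)
  set B := ∑ g : Fin s → R, ind (¬ Function.Injective g)
  set n := (Fintype.card V : ℝ)
  set r := (R.card : ℝ)
  have h7 : Z ^ s * r ≤ 2 * (s : ℝ) ^ 2 * n ^ s * r ^ k * r := by
    calc Z ^ s * r ≤ (r ^ s * s + n * B) * n ^ k * r := by
          gcongr
          exact h1.trans (mul_le_mul_of_nonneg_right h4 (by positivity))
      _ = n ^ k * (r ^ s * s * r + n * (B * r)) := by ring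
      _ ≤ n ^ k * (r ^ s * s ^ 2 * n + n * (s ^ 2 * r ^ s)) := by
          gcongr
          nlinarith
      _ = _ := by rw [hsd]; ring
  exact le_of_mul_le_mul_right h7 hRp

lemma KssFree.sum_le {V : Type*} [Fintype V] {s : ℕ} (hs : 2 ≤ s) {A : V → V → Prop}
    (hA : KssFree s A) (R : Finset V) {ρ ζ : ℝ} (hζ : 0 ≤ ζ)
    (hR : (R.card : ℝ) ≤ ρ * Fintype.card V) (h : 2 * (s : ℝ) ^ 2 * ρ ^ (s - 1) ≤ ζ ^ s) :
    ∑ x ∈ R, ∑ y, ind (A x y) ≤ ζ * (Fintype.card V : ℝ) ^ ((2 : ℝ) - 1 / s) := by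
  have hs0 : s ≠ 0 := by omega
  have hsr : (s : ℝ) ≠ 0 := by exact_mod_cast hs0
  refine le_of_pow_le_pow_left₀ hs0 (by positivity) ((hA.pow_sum_le hs R).trans ?_)
  set n := (Fintype.card V : ℝ)
  have hn : 0 ≤ n := Nat.cast_nonneg _
  have e1 : (n ^ ((2 : ℝ) - 1 / s)) ^ s = n ^ s * n ^ (s - 1) := by
    rw [← Real.rpow_natCast (n ^ _), ← Real.rpow_mul hn, ← pow_add, ← Real.rpow_natCast n]
    congr 1
    rw [sub_mul, one_div, inv_mul_cancel₀ hsr]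
    push_cast [Nat.cast_sub (show 1 ≤ s by omega)]
    ring
  rw [mul_pow, e1]
  calc 2 * (s : ℝ) ^ 2 * n ^ s * (R.card : ℝ) ^ (s - 1)
      ≤ 2 * (s : ℝ) ^ 2 * n ^ s * (ρ * n) ^ (s - 1) := by gcongr
    _ = 2 * (s : ℝ) ^ 2 * ρ ^ (s - 1) * (n ^ s * n ^ (s - 1)) := by rw [mul_pow]; ring
    _ ≤ _ := by gcongr

lemma KssFree.sum_univ_le {V : Type*} [Fintype V] {s : ℕ} (hs : 2 ≤ s) {A : V → V → Prop}
    (hA : KssFree s A) :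
    ∑ x, ∑ y, ind (A x y) ≤ 2 * (s : ℝ) ^ 2 * (Fintype.card V : ℝ) ^ ((2 : ℝ) - 1 / s) := by
  refine hA.sum_le hs univ (ρ := 1) (by positivity) (by simp) ?_
  rw [one_pow, mul_one]
  refine le_self_pow₀ ?_ (by omega)
  have : (2 : ℝ) ≤ s := by exact_mod_cast hs
  nlinarith

lemma card_le_exThree {W : Type*} [DecidableEq W] {N : ℕ} {F : Finset (Finset W)}
    {H : Finset (Finset (Fin N))} (h3 : ∀ e ∈ H, e.card = 3) (hF : ¬ HasCopy H F) :
    H.card ≤ exThree N F :=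
  le_csSup ⟨Fintype.card (Finset (Fin N)), fun _ ⟨H, _, _, hk⟩ => hk ▸ card_le_univ H⟩
    ⟨H, h3, hF, rfl⟩

lemma card_le_exBip {M N t s : ℕ} {H : Finset (Finset (Fin M ⊕ Fin N))} (hH : BipShape M N H)
    (hF : ¬ HasBipKtss M N t s H) : H.card ≤ exBip M N t s :=
  le_csSup ⟨Fintype.card (Finset (Fin M ⊕ Fin N)), fun _ ⟨H, _, _, hk⟩ => hk ▸ card_le_univ H⟩
    ⟨H, hH, hF, rfl⟩

lemma exThree_le {W : Type*} [DecidableEq W] {n : ℕ} {F : Finset (Finset W)} {b : ℝ} (hb : 0 ≤ b)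
    (h : ∀ H : Finset (Finset (Fin n)), (∀ e ∈ H, e.card = 3) → ¬ HasCopy H F → (H.card : ℝ) ≤ b) :
    (exThree n F : ℝ) ≤ b := by
  rcases Set.eq_empty_or_nonempty {k | ∃ H : Finset (Finset (Fin n)), (∀ e ∈ H, e.card = 3) ∧
    ¬ HasCopy H F ∧ H.card = k} with h0 | h0
  · rw [exThree, h0]; simpa using hb
  · obtain ⟨H, h3, hF, hk⟩ := Nat.sSup_mem h0
      ⟨Fintype.card (Finset (Fin n)), fun _ ⟨H, _, _, hk⟩ => hk ▸ card_le_univ H⟩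
    rw [exThree, ← hk]
    exact h H h3 hF

lemma image_image_eq {V B : Type*} [DecidableEq V] [DecidableEq B] {U : Finset V} {h : V → B}
    {τ : B → V} (hτ : ∀ x ∈ U, τ (h x) = x) {e : Finset V} (he : e ⊆ U) :
    (e.image h).image τ = e := by
  rw [image_image]
  calc e.image (τ ∘ h) = e.image id := image_congr fun x hx => hτ x (he hx)
    _ = e := image_id

lemma card_image_image {V B : Type*} [DecidableEq V] [DecidableEq B] {U : Finset V} {h : V → B}
    {τ : B → V} (hτ : ∀ x ∈ U, τ (h x) = x) {E : Finset (Finset V)} (hE : ∀ e ∈ E, e ⊆ U) :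
    (E.image (image h)).card = E.card :=
  card_image_of_injOn fun e he e' he' hee => by
    rw [← image_image_eq hτ (hE e he), ← image_image_eq hτ (hE e' he')]
    exact congrArg _ hee

lemma exists_injOn_fin {V : Type*} [DecidableEq V] (U : Finset V) {N : ℕ} (hN : 0 < N)
    (hU : U.card ≤ N) : ∃ f : V → Fin N, Set.InjOn f U := by
  refine ⟨fun x => if h : x ∈ U then Fin.castLE hU (U.equivFin ⟨x, h⟩) else ⟨0, hN⟩, ?_⟩
  intro x hx y hy hxy
  simp only [mem_coe] at hx hy
  simp only [hx, hy, dif_pos] at hxy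
  have := U.equivFin.injective (Fin.castLE_injective hU hxy)
  exact congrArg Subtype.val this

/-- No vertex of `H` has a `K_{s,s}` inside `U` in its link. -/
def NoLinkKss {V : Type*} [DecidableEq V] (s : ℕ) (H : Finset (Finset V)) (U : Finset V) : Prop :=
  ∀ (v : V) (α β : Fin s → V), Function.Injective α → Function.Injective β →
    (∀ i, α i ∈ U) → (∀ i, β i ∈ U) → ¬ ∀ i j, ({v, α i, β j} : Finset V) ∈ H

lemma card_inside_le {V : Type*} [DecidableEq V] {s N : ℕ} (hs : 0 < s) (hN : 0 < N)
    {H : Finset (Finset V)} (h3 : ∀ e ∈ H, e.card = 3) {U : Finset V} (hU : U.card ≤ N)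
    (hK : NoLinkKss s H U) :
    (H.filter (· ⊆ U)).card ≤ exThree N (Ktss 1 s) := by
  classical
  rcases U.eq_empty_or_nonempty with rfl | ⟨u0, hu0⟩
  · rw [filter_eq_empty_iff.2, card_empty]
    · exact Nat.zero_le _
    · intro e he hsub
      have := h3 e he
      rw [subset_empty.1 hsub] at this
      simp at this
  obtain ⟨h, hinj⟩ := exists_injOn_fin U hN hU
  have : Nonempty V := ⟨u0⟩
  set τ := Function.invFunOn h (U : Set V)
  have hτ : ∀ x ∈ U, τ (h x) = x := fun x hx => hinj.leftInvOn_invFunOn hx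
  have hE : ∀ e ∈ H.filter (· ⊆ U), e ⊆ U := fun e he => (mem_filter.1 he).2
  rw [← card_image_image hτ hE]
  apply card_le_exThree
  · intro e' he'
    obtain ⟨e, he, rfl⟩ := mem_image.1 he'
    rw [card_image_of_injOn (hinj.mono (by exact_mod_cast hE e he))]
    exact h3 e (mem_filter.1 he).1
  · rintro ⟨f, hf⟩
    have key : ∀ i j, ({f (Sum.inl 0), f (Sum.inr (Sum.inl i)), f (Sum.inr (Sum.inr j))} :
        Finset (Fin N)) ∈ (H.filter (· ⊆ U)).image (image h) := by
      intro i j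
      have := hf {Sum.inl 0, Sum.inr (Sum.inl i), Sum.inr (Sum.inr j)}
        (mem_image.2 ⟨(0, i, j), mem_univ _, rfl⟩)
      simpa [image_insert] using this
    have hback : ∀ e' ∈ (H.filter (· ⊆ U)).image (image h), ∀ y ∈ e', τ y ∈ U ∧ h (τ y) = y := by
      intro e' he' y hy
      obtain ⟨e, he, rfl⟩ := mem_image.1 he'
      obtain ⟨x, hx, rfl⟩ := mem_image.1 hy
      have hxU := hE e he hx
      rw [hτ x hxU]
      exact ⟨hxU, rfl⟩
    have hα : ∀ i, τ (f (Sum.inr (Sum.inl i))) ∈ U ∧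
        h (τ (f (Sum.inr (Sum.inl i)))) = f (Sum.inr (Sum.inl i)) := fun i =>
      hback _ (key i ⟨0, hs⟩) _ (by simp)
    have hβ : ∀ i, τ (f (Sum.inr (Sum.inr i))) ∈ U ∧
        h (τ (f (Sum.inr (Sum.inr i)))) = f (Sum.inr (Sum.inr i)) := fun i =>
      hback _ (key ⟨0, hs⟩ i) _ (by simp)
    refine hK (τ (f (Sum.inl 0))) (fun i => τ (f (Sum.inr (Sum.inl i))))
      (fun j => τ (f (Sum.inr (Sum.inr j)))) ?_ ?_ (fun i => (hα i).1) (fun i => (hβ i).1) ?_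
    · intro i j hij
      have := congrArg h hij
      simp only [(hα _).2] at this
      simpa using f.injective this
    · intro i j hij
      have := congrArg h hij
      simp only [(hβ _).2] at this
      simpa using f.injective this
    · intro i j
      obtain ⟨e, he, hee⟩ := mem_image.1 (key i j)
      have := image_image_eq hτ (hE e he)
      rw [hee] at this
      have h2 := (mem_filter.1 he).1
      rw [← this] at h2
      simpa [image_insert] using h2

lemma card_bip_le {V : Type*} [DecidableEq V] {s N : ℕ} (hs : 0 < s) (hN : 0 < N)
    {H : Finset (Finset V)} {U W : Finset V} (hUW : Disjoint U W)
    (hU : U.card ≤ N) (hW : W.card ≤ N) (hK : NoLinkKss s H W)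
    {E : Finset (Finset V)} (hEH : E ⊆ H)
    (hE : ∀ e ∈ E, ∃ a ∈ U, ∃ b ∈ W, ∃ c ∈ W, b ≠ c ∧ e = {a, b, c}) :
    E.card ≤ exBip N N 1 s := by
  classical
  rcases E.eq_empty_or_nonempty with rfl | ⟨e0, he0⟩
  · simp
  obtain ⟨a0, -, -⟩ := hE e0 he0
  have : Nonempty V := ⟨a0⟩
  obtain ⟨f, hf⟩ := exists_injOn_fin U hN hU
  obtain ⟨g, hg⟩ := exists_injOn_fin W hN hW
  let h : V → Fin N ⊕ Fin N := fun x => if x ∈ U then Sum.inl (f x) else Sum.inr (g x)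
  have hhU : ∀ x ∈ U, h x = Sum.inl (f x) := fun x hx => by simp [h, hx]
  have hhW : ∀ x ∈ W, h x = Sum.inr (g x) := fun x hx => by
    simp [h, disjoint_right.1 hUW hx]
  have hinj : Set.InjOn h (U ∪ W : Finset V) := by
    intro x hx y hy hxy
    simp only [coe_union, Set.mem_union, mem_coe] at hx hy
    rcases hx with hx | hx <;> rcases hy with hy | hy
    · rw [hhU x hx, hhU y hy] at hxy; exact hf hx hy (Sum.inl_injective hxy)
    · rw [hhU x hx, hhW y hy] at hxy; cases hxy
    · rw [hhW x hx, hhU y hy] at hxy; cases hxy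
    · rw [hhW x hx, hhW y hy] at hxy; exact hg hx hy (Sum.inr_injective hxy)
  set τ := Function.invFunOn h ((U ∪ W : Finset V) : Set V)
  have hτ : ∀ x ∈ U ∪ W, τ (h x) = x := fun x hx => hinj.leftInvOn_invFunOn hx
  have hE' : ∀ e ∈ E, e ⊆ U ∪ W := by
    intro e he
    obtain ⟨a, ha, b, hb, c, hc, -, rfl⟩ := hE e he
    intro x hx
    simp only [mem_insert, mem_singleton] at hx
    rcases hx with rfl | rfl | rfl <;> simp [*]
  rw [← card_image_image hτ hE']
  apply card_le_exBip
  · intro e' he'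
    obtain ⟨e, he, rfl⟩ := mem_image.1 he'
    obtain ⟨a, ha, b, hb, c, hc, hbc, rfl⟩ := hE e he
    exact ⟨f a, g b, g c, fun h => hbc (hg hb hc h),
      by simp [image_insert, hhU a ha, hhW b hb, hhW c hc]⟩
  · rintro ⟨T, S0, S1, hT, hS0, hS1, -, hTS⟩
    obtain ⟨t, rfl⟩ := card_eq_one.1 hT
    have key : ∀ b ∈ S0, ∀ c ∈ S1, ({Sum.inl t, Sum.inr b, Sum.inr c} :
        Finset (Fin N ⊕ Fin N)) ∈ E.image (image h) := fun b hb c hc =>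
      hTS t (mem_singleton_self t) b hb c hc
    have hback : ∀ e' ∈ E.image (image h), ∀ y, Sum.inr y ∈ e' →
        τ (Sum.inr y) ∈ W ∧ h (τ (Sum.inr y)) = Sum.inr y := by
      intro e' he' y hy
      obtain ⟨e, he, rfl⟩ := mem_image.1 he'
      obtain ⟨x, hx, hxy⟩ := mem_image.1 hy
      have hxU := hE' e he hx
      rw [← hxy, hτ x hxU]
      refine ⟨?_, rfl⟩
      rcases mem_union.1 hxU with hx' | hx'
      · rw [hhU x hx'] at hxy; cases hxy
      · exact hx'
    obtain ⟨b0, hb0⟩ := card_pos.1 (hS0 ▸ hs)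
    obtain ⟨c0, hc0⟩ := card_pos.1 (hS1 ▸ hs)
    have hα : ∀ b ∈ S0, τ (Sum.inr b) ∈ W ∧ h (τ (Sum.inr b)) = Sum.inr b := fun b hb =>
      hback _ (key b hb c0 hc0) _ (by simp)
    have hβ : ∀ c ∈ S1, τ (Sum.inr c) ∈ W ∧ h (τ (Sum.inr c)) = Sum.inr c := fun c hc =>
      hback _ (key b0 hb0 c hc) _ (by simp)
    let p : Fin s → S0 := fun i => S0.equivFin.symm (Fin.cast hS0.symm i)
    let q : Fin s → S1 := fun i => S1.equivFin.symm (Fin.cast hS1.symm i)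
    refine hK (τ (Sum.inl t)) (fun i => τ (Sum.inr (p i))) (fun j => τ (Sum.inr (q j))) ?_ ?_
      (fun i => (hα _ (p i).2).1) (fun i => (hβ _ (q i).2).1) ?_
    · intro i j hij
      have := congrArg h hij
      simp only [(hα _ (p _).2).2] at this
      have := S0.equivFin.symm.injective (Subtype.val_injective (Sum.inr_injective this))
      exact Fin.cast_injective _ this
    · intro i j hij
      have := congrArg h hij
      simp only [(hβ _ (q _).2).2] at this
      have := S1.equivFin.symm.injective (Subtype.val_injective (Sum.inr_injective this))
      exact Fin.cast_injective _ this
    · intro i j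
      obtain ⟨e, he, hee⟩ := mem_image.1 (key (p i) (p i).2 (q j) (q j).2)
      have := image_image_eq hτ (hE' e he)
      rw [hee] at this
      have h2 := hEH he
      rw [← this] at h2
      simpa [image_insert] using h2

lemma six_mul_card_le {V : Type*} [Fintype V] [DecidableEq V] {H : Finset (Finset V)}
    (h3 : ∀ e ∈ H, e.card = 3) :
    6 * (H.card : ℝ) ≤ ∑ a, ∑ b, ∑ c, ind (({a, b, c} : Finset V) ∈ H) := by
  have key : ∀ e ∈ H, 6 ≤ (univ.filter fun t : V × V × V => ({t.1, t.2.1, t.2.2} : Finset V) = e).card := by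
    intro e he
    obtain ⟨x, y, z, hxy, hxz, hyz, rfl⟩ := card_eq_three.1 (h3 e he)
    calc 6 = ({(x, y, z), (x, z, y), (y, x, z), (y, z, x), (z, x, y), (z, y, x)} :
          Finset (V × V × V)).card := by
          rw [card_insert_of_notMem, card_insert_of_notMem, card_insert_of_notMem,
            card_insert_of_notMem, card_insert_of_notMem, card_singleton] <;>
          simp [hxy, hxz, hyz, hxy.symm, hxz.symm, hyz.symm]
      _ ≤ _ := by
          apply card_le_card
          intro t ht
          simp only [mem_insert, mem_singleton] at ht
          simp only [mem_filter, mem_univ, true_and]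
          rcases ht with rfl | rfl | rfl | rfl | rfl | rfl <;> ext u <;>
            simp only [mem_insert, mem_singleton] <;> tauto
  have h1 : ∑ a, ∑ b, ∑ c, ind (({a, b, c} : Finset V) ∈ H)
      = ((univ.filter fun t : V × V × V => ({t.1, t.2.1, t.2.2} : Finset V) ∈ H).card : ℝ) := by
    rw [← sum_ind_eq_card, Fintype.sum_prod_type]
    exact sum_congr rfl fun a _ => by rw [Fintype.sum_prod_type]
  have h2 := card_eq_sum_card_fiberwise
    (s := univ.filter fun t : V × V × V => ({t.1, t.2.1, t.2.2} : Finset V) ∈ H)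
    (f := fun t : V × V × V => ({t.1, t.2.1, t.2.2} : Finset V))
    (t := H) (fun t ht => by simpa using ht)
  rw [h1, h2]
  have : 6 * H.card ≤ ∑ b ∈ H, ((univ.filter fun t : V × V × V =>
      ({t.1, t.2.1, t.2.2} : Finset V) ∈ H).filter
        fun t => ({t.1, t.2.1, t.2.2} : Finset V) = b).card := by
    calc 6 * H.card = ∑ _e ∈ H, 6 := by simp [mul_comm]
      _ ≤ _ := by
        refine sum_le_sum fun e he => (key e he).trans (card_le_card ?_)
        intro t ht
        simp only [mem_filter, mem_univ, true_and] at ht ⊢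
        exact ⟨ht ▸ he, ht⟩
  exact_mod_cast this

lemma pow_three_le_card_T3 (N : ℕ) : N ^ 3 ≤ (T3 (3 * N)).card := by
  let f : Fin N × Fin N × Fin N → Finset (Fin (3 * N)) := fun t =>
    {⟨3 * t.1, by omega⟩, ⟨3 * t.2.1 + 1, by omega⟩, ⟨3 * t.2.2 + 2, by omega⟩}
  have hmem : ∀ t, f t ∈ T3 (3 * N) := by
    rintro ⟨i, j, k⟩
    have hcard : (f (i, j, k)).card = 3 := by
      rw [card_eq_three]
      refine ⟨_, _, _, ?_, ?_, ?_, rfl⟩ <;> rw [Ne, Fin.mk.injEq] <;> omega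
    refine mem_filter.2 ⟨mem_univ _, hcard, fun c => ?_⟩
    rw [card_eq_one]
    fin_cases c
    · refine ⟨⟨3 * i, by omega⟩, ?_⟩
      ext ⟨x, hx⟩
      simp only [f, turanPart, mem_inter, mem_insert, mem_singleton, mem_filter, mem_univ,
        true_and, Fin.mk.injEq]
      omega
    · refine ⟨⟨3 * j + 1, by omega⟩, ?_⟩
      ext ⟨x, hx⟩
      simp only [f, turanPart, mem_inter, mem_insert, mem_singleton, mem_filter, mem_univ,
        true_and, Fin.mk.injEq]
      omega
    · refine ⟨⟨3 * k + 2, by omega⟩, ?_⟩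
      ext ⟨x, hx⟩
      simp only [f, turanPart, mem_inter, mem_insert, mem_singleton, mem_filter, mem_univ,
        true_and, Fin.mk.injEq]
      omega
  have hinj : Function.Injective f := by
    rintro ⟨i, j, k⟩ ⟨i', j', k'⟩ h
    have a1 : (⟨3 * i, by omega⟩ : Fin (3 * N)) ∈ f (i', j', k') := h ▸ by simp [f]
    have a2 : (⟨3 * j + 1, by omega⟩ : Fin (3 * N)) ∈ f (i', j', k') := h ▸ by simp [f]
    have a3 : (⟨3 * k + 2, by omega⟩ : Fin (3 * N)) ∈ f (i', j', k') := h ▸ by simp [f]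
    simp only [f, mem_insert, mem_singleton, Fin.mk.injEq] at a1 a2 a3
    simp only [Prod.mk.injEq, Fin.ext_iff]
    omega
  calc N ^ 3 = (univ : Finset (Fin N × Fin N × Fin N)).card := by simp; ring
    _ ≤ _ := card_le_card_of_injOn f (fun t _ => hmem t) hinj.injOn

lemma sum_comp_colour {V : Type*} [Fintype V] (χ : V → Fin 3) (F : Fin 3 → ℝ) :
    ∑ x, F (χ x) = ∑ i, (univ.filter fun x => χ x = i).card * F i := by
  rw [← sum_fiberwise univ χ]
  refine sum_congr rfl fun i _ => ?_
  rw [← nsmul_eq_mul]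
  exact sum_eq_card_nsmul fun x hx => by rw [(mem_filter.1 hx).2]

/-- The product of the sizes of the colour classes. -/
noncomputable def classProd {V : Type*} [Fintype V] (χ : V → Fin 3) : ℝ :=
  ∏ i, ((univ.filter fun x => χ x = i).card : ℝ)

lemma sum_rainbow_eq {V : Type*} [Fintype V] (χ : V → Fin 3) :
    ∑ a, ∑ b, ∑ c, ind (Rainbow χ a b c) = 6 * classProd χ := by
  unfold Rainbow
  have e1 : ∀ a b, ∑ c, ind (χ a ≠ χ b ∧ χ a ≠ χ c ∧ χ b ≠ χ c) = _ := fun a b =>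
    sum_comp_colour χ fun k => ind (χ a ≠ χ b ∧ χ a ≠ k ∧ χ b ≠ k)
  have e2 : ∀ a, ∑ b, ∑ k, ((univ.filter fun x => χ x = k).card : ℝ)
      * ind (χ a ≠ χ b ∧ χ a ≠ k ∧ χ b ≠ k) = _ := fun a =>
    sum_comp_colour χ fun j => ∑ k, ((univ.filter fun x => χ x = k).card : ℝ)
      * ind (χ a ≠ j ∧ χ a ≠ k ∧ j ≠ k)
  simp only [e1, e2]
  rw [sum_comp_colour χ fun i => ∑ j, ((univ.filter fun x => χ x = j).card : ℝ) *
    ∑ k, ((univ.filter fun x => χ x = k).card : ℝ) * ind (i ≠ j ∧ i ≠ k ∧ j ≠ k)]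
  simp [Fin.sum_univ_three, ind, classProd, Fin.prod_univ_three]
  ring

lemma sum_rainbow_colour_eq {V : Type*} [Fintype V] (χ : V → Fin 3) (l : Fin 3) :
    ∑ a, ∑ b, ∑ c, ind (Rainbow χ a b c ∧ χ a = l) = 2 * classProd χ := by
  unfold Rainbow
  have e1 : ∀ a b, ∑ c, ind ((χ a ≠ χ b ∧ χ a ≠ χ c ∧ χ b ≠ χ c) ∧ χ a = l) = _ := fun a b =>
    sum_comp_colour χ fun k => ind ((χ a ≠ χ b ∧ χ a ≠ k ∧ χ b ≠ k) ∧ χ a = l)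
  have e2 : ∀ a, ∑ b, ∑ k, ((univ.filter fun x => χ x = k).card : ℝ)
      * ind ((χ a ≠ χ b ∧ χ a ≠ k ∧ χ b ≠ k) ∧ χ a = l) = _ := fun a =>
    sum_comp_colour χ fun j => ∑ k, ((univ.filter fun x => χ x = k).card : ℝ)
      * ind ((χ a ≠ j ∧ χ a ≠ k ∧ j ≠ k) ∧ χ a = l)
  simp only [e1, e2]
  rw [sum_comp_colour χ fun i => ∑ j, ((univ.filter fun x => χ x = j).card : ℝ) *
    ∑ k, ((univ.filter fun x => χ x = k).card : ℝ) * ind ((i ≠ j ∧ i ≠ k ∧ j ≠ k) ∧ i = l)]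
  fin_cases l <;> simp [Fin.sum_univ_three, ind, classProd, Fin.prod_univ_three] <;> ring

lemma sum_class_card {V : Type*} [Fintype V] (χ : V → Fin 3) :
    ∑ i, ((univ.filter fun x => χ x = i).card : ℝ) = Fintype.card V := by
  have := sum_comp_colour χ fun _ => 1
  simpa using this.symm

lemma mul_mul_le_of_sum {x y z n : ℝ} (hx : 0 ≤ x) (hy : 0 ≤ y) (hz : 0 ≤ z)
    (h : x + y + z = n) : 27 * (x * y * z) ≤ n ^ 3 := by
  subst h
  nlinarith [mul_nonneg hx (sq_nonneg (y - z)), mul_nonneg hy (sq_nonneg (x - z)),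
    mul_nonneg hz (sq_nonneg (x - y)), mul_nonneg hx (sq_nonneg (x - y)),
    mul_nonneg hx (sq_nonneg (x - z)), mul_nonneg hy (sq_nonneg (x - y)),
    mul_nonneg hy (sq_nonneg (y - z)), mul_nonneg hz (sq_nonneg (x - z)),
    mul_nonneg hz (sq_nonneg (y - z))]

lemma classProd_le {V : Type*} [Fintype V] (χ : V → Fin 3) :
    27 * classProd χ ≤ (Fintype.card V : ℝ) ^ 3 := by
  have h := sum_class_card χ
  rw [Fin.sum_univ_three] at h
  rw [classProd, Fin.prod_univ_three]
  exact mul_mul_le_of_sum (Nat.cast_nonneg _) (Nat.cast_nonneg _) (Nat.cast_nonneg _) h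

lemma le_of_mul_mul_ge {x y z n ρ δ : ℝ} (hx : 0 ≤ x) (hy : 0 ≤ y) (hz : 0 ≤ z) (hn : 0 < n)
    (h : x + y + z = n) (hρ : 0 ≤ ρ) (hδ : 2 * δ ≤ ρ ^ 2)
    (hp : (2 / 9 - δ) * n ^ 3 ≤ 6 * (x * y * z)) : x ≤ n / 3 + ρ * n := by
  by_contra! hlt
  set t := x - n / 3 with ht
  have ht0 : ρ * n < t := by linarith
  have htn : t ≤ 2 / 3 * n := by linarith
  have hyz : 4 * (y * z) ≤ (2 / 3 * n - t) ^ 2 := by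
    have : 2 / 3 * n - t = y + z := by linarith
    rw [this]; nlinarith [sq_nonneg (y - z)]
  have h1 : 4 * (x * y * z) ≤ x * (2 / 3 * n - t) ^ 2 := by nlinarith
  have hxt : x = t + n / 3 := by linarith
  rw [hxt] at h1 hp
  have hρn : 0 ≤ ρ * n := by positivity
  have h2 : (ρ * n) ^ 2 < t ^ 2 := by nlinarith
  have h3 : 0 ≤ t ^ 2 * (2 / 3 * n - t) := mul_nonneg (sq_nonneg _) (by linarith)
  have h4 : (2 / 9 - δ) * n ^ 3 ≤ 2 / 9 * n ^ 3 - n * t ^ 2 / 2 := by nlinarith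
  have h5 : n * t ^ 2 ≤ n * (2 * δ * n ^ 2) := by nlinarith
  have h6 := le_of_mul_le_mul_left h5 hn
  nlinarith [mul_le_mul_of_nonneg_right hδ (sq_nonneg n)]

lemma class_card_le {V : Type*} [Fintype V] [Nonempty V] {χ : V → Fin 3} {ρ δ : ℝ} (hρ : 0 ≤ ρ)
    (hδ : 2 * δ ≤ ρ ^ 2) (hp : (2 / 9 - δ) * (Fintype.card V : ℝ) ^ 3 ≤ 6 * classProd χ)
    (i : Fin 3) :
    ((univ.filter fun x => χ x = i).card : ℝ) ≤ Fintype.card V / 3 + ρ * Fintype.card V := by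
  have hn : (0 : ℝ) < Fintype.card V := by exact_mod_cast Fintype.card_pos
  have h := sum_class_card χ
  rw [Fin.sum_univ_three] at h
  rw [classProd, Fin.prod_univ_three] at hp
  obtain rfl | rfl | rfl : i = 0 ∨ i = 1 ∨ i = 2 := by omega
  · exact le_of_mul_mul_ge (Nat.cast_nonneg _) (Nat.cast_nonneg _) (Nat.cast_nonneg _) hn h hρ hδ hp
  · refine le_of_mul_mul_ge (y := (univ.filter fun x => χ x = 0).card)
      (z := (univ.filter fun x => χ x = 2).card) (Nat.cast_nonneg _) (Nat.cast_nonneg _)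
      (Nat.cast_nonneg _) hn (by rw [← h]; ring) hρ hδ (hp.trans_eq ?_)
    ring
  · refine le_of_mul_mul_ge (y := (univ.filter fun x => χ x = 0).card)
      (z := (univ.filter fun x => χ x = 1).card) (Nat.cast_nonneg _) (Nat.cast_nonneg _)
      (Nat.cast_nonneg _) hn (by rw [← h]; ring) hρ hδ (hp.trans_eq ?_)
    ring

section Cut

variable {V : Type} [Fintype V] [DecidableEq V]

/-- The triple `a`, `b`, `c` spans an edge of `H`. -/
def IsEdge (H : Finset (Finset V)) (a b c : V) : Prop := ({a, b, c} : Finset V) ∈ H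

omit [Fintype V] in
lemma IsEdge.swap_left {H : Finset (Finset V)} (a b c : V) (h : IsEdge H a b c) :
    IsEdge H b a c := by
  unfold IsEdge at h ⊢; rwa [insert_comm]

omit [Fintype V] in
lemma IsEdge.swap_right {H : Finset (Finset V)} (a b c : V) (h : IsEdge H a b c) :
    IsEdge H a c b := by
  unfold IsEdge at h ⊢; rwa [pair_comm]

omit [Fintype V] in
lemma isEdge_rotate {H : Finset (Finset V)} (a b c : V) : IsEdge H a b c ↔ IsEdge H b c a :=
  ⟨fun h => .swap_right _ _ _ (.swap_left _ _ _ h), fun h => .swap_left _ _ _ (.swap_right _ _ _ h)⟩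

omit [Fintype V] [DecidableEq V] in
lemma rainbow_rotate {χ : V → Fin 3} (a b c : V) : Rainbow χ a b c ↔ Rainbow χ b c a := by
  unfold Rainbow; grind

/-- The number of ordered rainbow edges. -/
noncomputable def cutSize (H : Finset (Finset V)) (χ : V → Fin 3) : ℝ :=
  ∑ a, ∑ b, ∑ c, ind (IsEdge H a b c ∧ Rainbow χ a b c)

/-- The number of ordered rainbow non-edges at `x`. -/
noncomputable def missing (H : Finset (Finset V)) (χ : V → Fin 3) (x : V) : ℝ :=
  ∑ p, ∑ q, ind (Rainbow χ x p q ∧ ¬ IsEdge H x p q)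

/-- The number of ordered edges at `w` which would be rainbow if `w` had colour `k`. -/
noncomputable def linkCut (H : Finset (Finset V)) (χ : V → Fin 3) (w : V) (k : Fin 3) : ℝ :=
  ∑ a, ∑ b, ind (IsEdge H w a b ∧ χ a ≠ χ b ∧ χ a ≠ k ∧ χ b ≠ k)

/-- The number of ordered non-rainbow edges at `w`. -/
noncomputable def linkBad (H : Finset (Finset V)) (χ : V → Fin 3) (w : V) : ℝ :=
  ∑ a, ∑ b, ind (IsEdge H w a b ∧ ¬ Rainbow χ w a b)

/-- The pairs of equally coloured vertices outside `W` in the link of `v`. -/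
def MonoLink (H : Finset (Finset V)) (χ : V → Fin 3) (W : Finset V) (v x y : V) : Prop :=
  IsEdge H v x y ∧ χ x = χ y ∧ x ∉ W ∧ y ∉ W

lemma missing_nonneg (H : Finset (Finset V)) (χ : V → Fin 3) (x : V) : 0 ≤ missing H χ x :=
  sum_nonneg fun _ _ => sum_nonneg fun _ _ => ind_nonneg _

lemma linkBad_le (H : Finset (Finset V)) (χ : V → Fin 3) (w : V) :
    linkBad H χ w ≤ (Fintype.card V : ℝ) ^ 2 := by
  calc linkBad H χ w ≤ ∑ _a : V, ∑ _b : V, (1 : ℝ) :=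
        sum_le_sum fun a _ => sum_le_sum fun b _ => ind_le_one _
    _ = _ := by simp; ring

lemma sum_missing (H : Finset (Finset V)) (χ : V → Fin 3) :
    ∑ x, missing H χ x = 6 * classProd χ - cutSize H χ := by
  rw [← sum_rainbow_eq, eq_sub_iff_add_eq]
  unfold missing cutSize
  simp only [← sum_add_distrib]
  refine sum_congr rfl fun a _ => sum_congr rfl fun b _ => sum_congr rfl fun c _ => ?_
  rw [ind_and, ind_and, ind_not]; ring

lemma cutSize_update {H : Finset (Finset V)} (h3 : ∀ e ∈ H, e.card = 3) (χ : V → Fin 3) (w : V)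
    (k : Fin 3) : cutSize H (Function.update χ w k)
      = (∑ a, ∑ b, ∑ c, ind ((IsEdge H a b c ∧ Rainbow χ a b c) ∧ a ≠ w ∧ b ≠ w ∧ c ≠ w))
        + 3 * linkCut H χ w k := by
  set χ' := Function.update χ w k with hχ'
  let F : V → V → V → ℝ := fun a b c => ind (IsEdge H a b c ∧ Rainbow χ' a b c) * ind (a = w)
  have key : ∀ a b c, ind (IsEdge H a b c ∧ Rainbow χ' a b c)
      = ind ((IsEdge H a b c ∧ Rainbow χ a b c) ∧ a ≠ w ∧ b ≠ w ∧ c ≠ w)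
        + F a b c + F b c a + F c a b := by
    intro a b c
    simp only [F]
    rw [← isEdge_rotate a b c, ← rainbow_rotate a b c, isEdge_rotate c a b, rainbow_rotate c a b]
    by_cases hE : IsEdge H a b c
    · obtain ⟨hab, hac, hbc⟩ := distinct_of_card_three (h3 _ hE)
      by_cases ha : a = w
      · subst ha
        simp [ind, hE, hab.symm, hac.symm]
      by_cases hb : b = w
      · subst hb
        simp [ind, hE, hab, hbc.symm]
      by_cases hc : c = w
      · subst hc
        simp [ind, hE, hac, hbc]
      · simp [ind, hE, ha, hb, hc, Rainbow, hχ', Function.update_of_ne]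
    · simp [ind, hE]
  have hF : ∑ a, ∑ b, ∑ c, F a b c = linkCut H χ w k := by
    rw [sum_eq_single w]
    · refine sum_congr rfl fun a _ => sum_congr rfl fun b _ => ?_
      simp only [F]
      rw [ind_of trivial, mul_one]
      refine ind_congr (and_congr_right fun hE => ?_)
      obtain ⟨hab, hac, hbc⟩ := distinct_of_card_three (h3 _ hE)
      simp only [Rainbow, hχ', Function.update_self, Function.update_of_ne hab.symm,
        Function.update_of_ne hac.symm]
      grind
    · intro a _ ha
      simp [F, ind_of_not ha]
    · simp
  unfold cutSize
  simp only [key, sum_add_distrib]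
  rw [sum_rotate F, ← sum_rotate fun a b c => F c a b, hF]
  ring

lemma linkCut_le_of_maximal {H : Finset (Finset V)} (h3 : ∀ e ∈ H, e.card = 3) {χ : V → Fin 3}
    (hmax : ∀ χ', cutSize H χ' ≤ cutSize H χ) (w : V) (k : Fin 3) :
    linkCut H χ w k ≤ linkCut H χ w (χ w) := by
  have h1 := hmax (Function.update χ w k)
  have h2 := cutSize_update h3 χ w (χ w)
  rw [Function.update_eq_self] at h2
  rw [cutSize_update h3, h2] at h1
  linarith

lemma linkCut_le_two_mul {H : Finset (Finset V)} {χ : V → Fin 3} {w : V} {k : Fin 3}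
    (hk : k ≠ χ w) :
    linkCut H χ w k ≤ 2 * ∑ x, ∑ y, ind (IsEdge H w x y ∧ χ x = χ w) := by
  have e1 : ∑ x, ∑ y, ind (IsEdge H w x y ∧ χ x = χ w)
      = ∑ x, ∑ y, ind (IsEdge H w x y ∧ χ y = χ w) := by
    rw [sum_comm]
    refine sum_congr rfl fun a _ => sum_congr rfl fun b _ => ind_congr (and_congr_left fun _ => ?_)
    exact ⟨.swap_right _ _ _, .swap_right _ _ _⟩
  rw [two_mul]
  nth_rewrite 2 [e1]
  unfold linkCut
  simp only [← sum_add_distrib]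
  refine sum_le_sum fun a _ => sum_le_sum fun b _ => ?_
  refine (ind_mono fun h => ?_).trans (ind_or_le _ _)
  obtain ⟨hE, h⟩ := h
  simp only [hE, true_and]
  omega

/-- Few vertices have a large cut in their link after recolouring. -/
lemma card_movable_lt {m s : ℕ} (hm : 2 * s ≤ m) {H : Finset (Finset V)}
    (h3 : ∀ e ∈ H, e.card = 3) (hF : ¬ HasCopy H (F5Stss m 1 s hm)) {χ : V → Fin 3}
    (hmax : ∀ χ', cutSize H χ' ≤ cutSize H χ) {γ δ : ℝ} (hγ : 0 ≤ γ) (hδ : δ ≤ γ ^ 2 / 4)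
    (hM : ∑ x, missing H χ x ≤ δ * (Fintype.card V : ℝ) ^ 3) {K : ℕ}
    (hK : ∀ Y : Finset V, K ≤ Y.card → γ ^ 2 / 4 * Y.card * (Fintype.card V : ℝ) ^ 4
      ≤ ∑ w ∈ Y, ∑ y, ∑ q, ∑ p, ∑ x,
        ind (({p, q, w} : Finset V) ∈ H ∧ ({p, q, x} : Finset V) ∈ H
          ∧ ({w, x, y} : Finset V) ∈ H) → HasCopy H (F5Stss m 1 s hm))
    (X : Finset V) (hX : ∀ w ∈ X, ∃ k, k ≠ χ w ∧
      γ * (Fintype.card V : ℝ) ^ 2 ≤ linkCut H χ w k) : X.card < K := by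
  by_contra! hlt
  refine hF (hK X hlt ?_)
  set n : ℝ := (Fintype.card V : ℝ)
  have hn : 0 ≤ n := Nat.cast_nonneg _
  have key : ∀ w ∈ X, γ ^ 2 / 4 * n ^ 4 ≤ ∑ y, ∑ q, ∑ p, ∑ x,
        ind (({p, q, w} : Finset V) ∈ H ∧ ({p, q, x} : Finset V) ∈ H
          ∧ ({w, x, y} : Finset V) ∈ H) := by
    intro w hw
    obtain ⟨k, hk, hγk⟩ := hX w hw
    have a1 := linkCut_le_two_mul (H := H) hk
    have a2 := linkCut_le_of_maximal h3 hmax w k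
    have pt : ∀ y q p x, ind (IsEdge H w x y ∧ χ x = χ w)
          * ind (IsEdge H w p q ∧ χ p ≠ χ q ∧ χ p ≠ χ w ∧ χ q ≠ χ w)
        ≤ ind (({p, q, w} : Finset V) ∈ H ∧ ({p, q, x} : Finset V) ∈ H
          ∧ ({w, x, y} : Finset V) ∈ H) + ind (Rainbow χ x p q ∧ ¬ IsEdge H x p q) := by
      intro y q p x
      rw [← ind_and]
      refine (ind_mono fun h => ?_).trans (ind_or_le _ _)
      obtain ⟨⟨b1, b2⟩, b3, b4⟩ := h
      by_cases hx : IsEdge H x p q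
      · left
        exact ⟨(isEdge_rotate _ _ _).1 b3, (isEdge_rotate _ _ _).1 hx, b1⟩
      · right
        refine ⟨?_, hx⟩
        unfold Rainbow; grind
    have hs := sum_le_sum fun y (_ : y ∈ (univ : Finset V)) =>
      sum_le_sum fun q (_ : q ∈ (univ : Finset V)) =>
        sum_le_sum fun p (_ : p ∈ (univ : Finset V)) =>
          sum_le_sum fun x (_ : x ∈ (univ : Finset V)) => pt y q p x
    have e1 : ∑ y, ∑ q, ∑ p, ∑ x, ind (IsEdge H w x y ∧ χ x = χ w)
          * ind (IsEdge H w p q ∧ χ p ≠ χ q ∧ χ p ≠ χ w ∧ χ q ≠ χ w)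
        = (∑ x, ∑ y, ind (IsEdge H w x y ∧ χ x = χ w)) * linkCut H χ w (χ w) := by
      rw [sum_comm (f := fun x y => ind (IsEdge H w x y ∧ χ x = χ w)), linkCut,
        sum_comm (f := fun a b => ind (IsEdge H w a b ∧ χ a ≠ χ b ∧ χ a ≠ χ w ∧ χ b ≠ χ w)),
        sum_mul]
      refine sum_congr rfl fun y _ => ?_
      rw [mul_sum]
      refine sum_congr rfl fun q _ => ?_
      rw [mul_sum]
      refine sum_congr rfl fun p _ => ?_
      rw [sum_mul]
    have e2 : ∑ _y : V, ∑ q, ∑ p, ∑ x, ind (Rainbow χ x p q ∧ ¬ IsEdge H x p q)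
        = n * ∑ x, missing H χ x := by
      rw [sum_const, card_univ, nsmul_eq_mul]
      congr 1
      calc ∑ q, ∑ p, ∑ x, ind (Rainbow χ x p q ∧ ¬ IsEdge H x p q)
          = ∑ q, ∑ x, ∑ p, ind (Rainbow χ x p q ∧ ¬ IsEdge H x p q) :=
            sum_congr rfl fun q _ => sum_comm
        _ = ∑ x, ∑ q, ∑ p, ind (Rainbow χ x p q ∧ ¬ IsEdge H x p q) := sum_comm
        _ = ∑ x, missing H χ x := sum_congr rfl fun x _ => sum_comm
    rw [e1] at hs
    simp only [sum_add_distrib] at hs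
    rw [e2] at hs
    have b1 : (γ * n ^ 2 / 2) * (γ * n ^ 2)
        ≤ (∑ x, ∑ y, ind (IsEdge H w x y ∧ χ x = χ w)) * linkCut H χ w (χ w) :=
      mul_le_mul (by linarith) (by linarith) (by positivity) (by linarith [mul_nonneg hγ (sq_nonneg n)])
    have b2 := mul_le_mul_of_nonneg_left hM hn
    have b3 := mul_le_mul_of_nonneg_right hδ (pow_nonneg hn 4)
    linarith
  calc γ ^ 2 / 4 * X.card * n ^ 4 = ∑ _w ∈ X, γ ^ 2 / 4 * n ^ 4 := by
        rw [sum_const, nsmul_eq_mul]; ring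
    _ ≤ _ := sum_le_sum key

lemma kssFree_monoLink {m s : ℕ} (hs : 2 ≤ s) (hm : 2 * s ≤ m) {H : Finset (Finset V)}
    (hF : ¬ HasCopy H (F5Stss m 1 s hm)) {χ : V → Fin 3} {W : Finset V} {δ : ℝ}
    (hδ : δ ≤ 1 / 1000) (hn : 200 ≤ Fintype.card V)
    (hM : ∑ x, missing H χ x ≤ δ * (Fintype.card V : ℝ) ^ 3)
    (hp : (2 / 9 - δ) * (Fintype.card V : ℝ) ^ 3 ≤ 6 * classProd χ)
    (hW : ∀ x ∉ W, s * missing H χ x ≤ 1 / 100 * (Fintype.card V : ℝ) ^ 2)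
    (v : V)
    (hK : ∀ α β : Fin s → V, Function.Injective α → Function.Injective β →
      (∀ i j, ({v, α i, β j} : Finset V) ∈ H) → 1 / 100 * (Fintype.card V : ℝ) ^ 3
      ≤ ∑ x, ∑ q, ∑ p, ind (({p, q, x} : Finset V) ∈ H ∧ (∀ i, ({p, q, α i} : Finset V) ∈ H)
        ∧ (∀ i, ({p, q, β i} : Finset V) ∈ H) ∧ p ≠ v ∧ q ≠ v) → HasCopy H (F5Stss m 1 s hm)) :
    KssFree s (MonoLink H χ W v) := by
  intro α β hα hβ hA
  refine hF (hK α β hα hβ (fun i j => (hA i j).1) ?_)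
  set n : ℝ := (Fintype.card V : ℝ) with hnd
  have hn' : (200 : ℝ) ≤ n := by rw [hnd]; exact_mod_cast hn
  let z : Fin s := ⟨0, by omega⟩
  set l := χ (α z) with hl
  have hβl : ∀ j, χ (β j) = l := fun j => (hA z j).2.1.symm
  have hαl : ∀ i, χ (α i) = l := fun i => (hA i z).2.1.trans (hβl z)
  have pt : ∀ x q p, ind (Rainbow χ x q p ∧ χ x = l)
      ≤ ind (({p, q, x} : Finset V) ∈ H ∧ (∀ i, ({p, q, α i} : Finset V) ∈ H)
        ∧ (∀ i, ({p, q, β i} : Finset V) ∈ H) ∧ p ≠ v ∧ q ≠ v)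
        + ind (Rainbow χ x q p ∧ ¬ IsEdge H x q p)
        + ∑ i, ind (Rainbow χ (α i) q p ∧ ¬ IsEdge H (α i) q p)
        + ∑ i, ind (Rainbow χ (β i) q p ∧ ¬ IsEdge H (β i) q p)
        + ind (p = v) + ind (q = v) := by
    intro x q p
    have hsum0 : ∀ f : Fin s → V, 0 ≤ ∑ i, ind (Rainbow χ (f i) q p ∧ ¬ IsEdge H (f i) q p) :=
      fun f => sum_nonneg fun _ _ => ind_nonneg _
    have g1 := hsum0 α
    have g2 := hsum0 β
    have g3 := ind_nonneg (Rainbow χ x q p ∧ ¬ IsEdge H x q p)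
    have g4 := ind_nonneg (p = v)
    have g5 := ind_nonneg (q = v)
    have g6 := ind_nonneg (({p, q, x} : Finset V) ∈ H ∧ (∀ i, ({p, q, α i} : Finset V) ∈ H)
        ∧ (∀ i, ({p, q, β i} : Finset V) ∈ H) ∧ p ≠ v ∧ q ≠ v)
    by_cases h : Rainbow χ x q p ∧ χ x = l
    swap
    · rw [ind_of_not h]; positivity
    rw [ind_of h]
    have hR : ∀ y, χ y = l → Rainbow χ y q p := by
      intro y hy
      have := h.1
      unfold Rainbow at this ⊢
      rwa [hy, ← h.2]
    have hrot : ∀ y, IsEdge H y q p → ({p, q, y} : Finset V) ∈ H := fun y hy =>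
      IsEdge.swap_left _ _ _ ((isEdge_rotate _ _ _).1 hy)
    by_cases c1 : IsEdge H x q p
    swap
    · rw [ind_of (P := Rainbow χ x q p ∧ ¬ IsEdge H x q p) ⟨h.1, c1⟩]; linarith
    by_cases c2 : ∀ i, IsEdge H (α i) q p
    swap
    · push Not at c2
      obtain ⟨i, hi⟩ := c2
      have := single_le_sum (f := fun i => ind (Rainbow χ (α i) q p ∧ ¬ IsEdge H (α i) q p))
        (fun _ _ => ind_nonneg _) (mem_univ i)
      rw [ind_of ⟨hR _ (hαl i), hi⟩] at this
      linarith
    by_cases c3 : ∀ i, IsEdge H (β i) q p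
    swap
    · push Not at c3
      obtain ⟨i, hi⟩ := c3
      have := single_le_sum (f := fun i => ind (Rainbow χ (β i) q p ∧ ¬ IsEdge H (β i) q p))
        (fun _ _ => ind_nonneg _) (mem_univ i)
      rw [ind_of ⟨hR _ (hβl i), hi⟩] at this
      linarith
    by_cases c4 : p = v
    · rw [ind_of c4]; linarith
    by_cases c5 : q = v
    · rw [ind_of c5]; linarith
    rw [ind_of (P := ({p, q, x} : Finset V) ∈ H ∧ (∀ i, ({p, q, α i} : Finset V) ∈ H)
        ∧ (∀ i, ({p, q, β i} : Finset V) ∈ H) ∧ p ≠ v ∧ q ≠ v)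
      ⟨hrot _ c1, fun i => hrot _ (c2 i), fun i => hrot _ (c3 i), c4, c5⟩]
    linarith
  have hsum := sum_le_sum fun x (_ : x ∈ (univ : Finset V)) =>
    sum_le_sum fun q (_ : q ∈ (univ : Finset V)) =>
      sum_le_sum fun p (_ : p ∈ (univ : Finset V)) => pt x q p
  simp only [sum_add_distrib] at hsum
  rw [sum_rainbow_colour_eq] at hsum
  have hf : ∀ f : Fin s → V, (∀ i, f i ∉ W) →
      ∑ _x : V, ∑ q, ∑ p, ∑ i, ind (Rainbow χ (f i) q p ∧ ¬ IsEdge H (f i) q p)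
        ≤ 1 / 100 * n ^ 3 := by
    intro f hfW
    have e1 : ∑ q, ∑ p, ∑ i, ind (Rainbow χ (f i) q p ∧ ¬ IsEdge H (f i) q p)
        = ∑ i, missing H χ (f i) :=
      calc ∑ q, ∑ p, ∑ i, ind (Rainbow χ (f i) q p ∧ ¬ IsEdge H (f i) q p)
          = ∑ q, ∑ i, ∑ p, ind (Rainbow χ (f i) q p ∧ ¬ IsEdge H (f i) q p) :=
            sum_congr rfl fun q _ => sum_comm
        _ = ∑ i, missing H χ (f i) := sum_comm
    rw [sum_const, card_univ, nsmul_eq_mul, e1]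
    have hs0 : (0 : ℝ) < s := by exact_mod_cast (by omega : 0 < s)
    have h1 : s * ∑ i, missing H χ (f i) ≤ s * (1 / 100 * n ^ 2) := by
      rw [mul_sum]
      refine (sum_le_sum fun i (_ : i ∈ univ) => hW (f i) (hfW i)).trans_eq ?_
      simp
    have h2 := le_of_mul_le_mul_left h1 hs0
    calc n * ∑ i, missing H χ (f i) ≤ n * (1 / 100 * n ^ 2) := by gcongr
      _ = _ := by ring
  have hα' := hf α fun i => (hA i z).2.2.1
  have hβ' := hf β fun i => (hA z i).2.2.2
  have e1 : ∑ _x : V, ∑ _q : V, ∑ p, ind (p = v) = n ^ 2 := by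
    have : ∑ p, ind (p = v) = 1 := by simp [sum_ind_eq_card, filter_eq']
    rw [this]; simp [hnd]; ring
  have e2 : ∑ _x : V, ∑ q, ∑ _p : V, ind (q = v) = n ^ 2 := by
    have : ∑ p, ind (p = v) = 1 := by simp [sum_ind_eq_card, filter_eq']
    simp only [sum_const, card_univ, nsmul_eq_mul, ← mul_sum, this, ← hnd]; ring
  rw [e1, e2] at hsum
  have hM' : ∑ x, ∑ q, ∑ p, ind (Rainbow χ x q p ∧ ¬ IsEdge H x q p) ≤ δ * n ^ 3 := hM
  have b1 : n ^ 2 * 200 ≤ n ^ 2 * n := mul_le_mul_of_nonneg_left hn' (sq_nonneg n)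
  have b2 := mul_le_mul_of_nonneg_right hδ (show 0 ≤ n ^ 3 by positivity)
  have b3 : 0 ≤ n ^ 3 := by positivity
  nlinarith

end Cut

section Assembly

variable {V : Type} [Fintype V] [DecidableEq V]

omit [DecidableEq V] in
lemma sum_ind_touching_le (R : Finset V) (P : V → V → V → Prop) (hP : ∀ a b c, P a b c → P b c a) :
    ∑ a, ∑ b, ∑ c, ind (P a b c ∧ (a ∈ R ∨ b ∈ R ∨ c ∈ R))
      ≤ 3 * ∑ a ∈ R, ∑ b, ∑ c, ind (P a b c) := by
  let F : V → V → V → ℝ := fun a b c => ind (P a b c ∧ a ∈ R)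
  have h1 : ∑ a ∈ R, ∑ b, ∑ c, ind (P a b c) = ∑ a, ∑ b, ∑ c, F a b c := by
    rw [← sum_subset (subset_univ R)]
    · refine sum_congr rfl fun a ha => sum_congr rfl fun b _ => sum_congr rfl fun c _ => ?_
      exact ind_congr (by simp [ha])
    · intro a _ ha
      simp [F, ha, ind]
  have key : ∀ a b c, ind (P a b c ∧ (a ∈ R ∨ b ∈ R ∨ c ∈ R)) ≤ F a b c + F b c a + F c a b := by
    intro a b c
    have t1 := ind_mono (P := P a b c ∧ (a ∈ R ∨ b ∈ R ∨ c ∈ R))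
      (Q := (P a b c ∧ a ∈ R ∨ P b c a ∧ b ∈ R) ∨ P c a b ∧ c ∈ R) (by grind)
    have t2 := ind_or_le (P a b c ∧ a ∈ R ∨ P b c a ∧ b ∈ R) (P c a b ∧ c ∈ R)
    have t3 := ind_or_le (P a b c ∧ a ∈ R) (P b c a ∧ b ∈ R)
    simp only [F]; linarith
  calc _ ≤ ∑ a, ∑ b, ∑ c, (F a b c + F b c a + F c a b) :=
        sum_le_sum fun a _ => sum_le_sum fun b _ => sum_le_sum fun c _ => key a b c
    _ = 3 * ∑ a, ∑ b, ∑ c, F a b c := by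
        simp only [sum_add_distrib]
        rw [sum_rotate F, ← sum_rotate fun a b c => F c a b]
        ring
    _ = _ := by rw [h1]

lemma linkBad_le_of_linkCut_le {H : Finset (Finset V)} {χ : V → Fin 3} (W : Finset V) (w : V) {B : ℝ}
    (hB : 0 ≤ B) (hc : ∀ k, k ≠ χ w → linkCut H χ w k ≤ B) :
    linkBad H χ w ≤ 2 * (W.card * Fintype.card V) + ∑ x, ∑ y, ind (MonoLink H χ W w x y) + 3 * B := by
  have pt : ∀ a b, ind (IsEdge H w a b ∧ ¬ Rainbow χ w a b) ≤ ind (a ∈ W) + ind (b ∈ W)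
      + ind (MonoLink H χ W w a b)
      + ∑ k, ind (k ≠ χ w) * ind (IsEdge H w a b ∧ χ a ≠ χ b ∧ χ a ≠ k ∧ χ b ≠ k) := by
    intro a b
    have hnn : 0 ≤ ∑ k, ind (k ≠ χ w) * ind (IsEdge H w a b ∧ χ a ≠ χ b ∧ χ a ≠ k ∧ χ b ≠ k) :=
      sum_nonneg fun k _ => mul_nonneg (ind_nonneg _) (ind_nonneg _)
    have n1 := ind_nonneg (a ∈ W)
    have n2 := ind_nonneg (b ∈ W)
    have n3 := ind_nonneg (MonoLink H χ W w a b)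
    have n4 := ind_le_one (IsEdge H w a b ∧ ¬ Rainbow χ w a b)
    by_cases h : IsEdge H w a b ∧ ¬ Rainbow χ w a b
    · by_cases ha : a ∈ W
      · rw [ind_of ha]; linarith
      by_cases hb : b ∈ W
      · rw [ind_of hb]; linarith
      by_cases hab : χ a = χ b
      · rw [ind_of (P := MonoLink H χ W w a b) ⟨h.1, hab, ha, hb⟩]; linarith
      obtain ⟨k, hk1, hk2⟩ : ∃ k : Fin 3, χ a ≠ k ∧ χ b ≠ k :=
        (by decide : ∀ i j : Fin 3, ∃ k, i ≠ k ∧ j ≠ k) _ _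
      have hk : k ≠ χ w := by
        rintro rfl
        exact h.2 ⟨hk1.symm, hk2.symm, hab⟩
      have := single_le_sum (f := fun k => ind (k ≠ χ w) *
        ind (IsEdge H w a b ∧ χ a ≠ χ b ∧ χ a ≠ k ∧ χ b ≠ k))
        (fun k _ => mul_nonneg (ind_nonneg _) (ind_nonneg _)) (mem_univ k)
      rw [ind_of hk, ind_of (P := IsEdge H w a b ∧ _) ⟨h.1, hab, hk1, hk2⟩] at this
      linarith
    · rw [ind_of_not h]; linarith
  have hW : ∑ a : V, ind (a ∈ W) = W.card := by
    rw [sum_ind_eq_card]; simp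
  have hs := sum_le_sum fun a (_ : a ∈ (univ : Finset V)) =>
    sum_le_sum fun b (_ : b ∈ (univ : Finset V)) => pt a b
  simp only [sum_add_distrib] at hs
  have e1 : ∑ a : V, ∑ _b : V, ind (a ∈ W) = W.card * Fintype.card V := by
    rw [sum_comm]; simp [hW, mul_comm]
  have e2 : ∑ _a : V, ∑ b : V, ind (b ∈ W) = W.card * Fintype.card V := by
    simp [hW, mul_comm]
  have e3 : ∑ a, ∑ b, ∑ k, ind (k ≠ χ w) * ind (IsEdge H w a b ∧ χ a ≠ χ b ∧ χ a ≠ k ∧ χ b ≠ k)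
      = ∑ k, ind (k ≠ χ w) * linkCut H χ w k := by
    unfold linkCut
    simp only [mul_sum]
    rw [sum_comm (s := (univ : Finset (Fin 3)))]
    exact sum_congr rfl fun a _ => sum_comm
  have e4 : ∑ k, ind (k ≠ χ w) * linkCut H χ w k ≤ ∑ _k : Fin 3, B := by
    refine sum_le_sum fun k _ => ?_
    by_cases hk : k = χ w
    · simpa [hk, ind] using hB
    · rw [ind_of hk, one_mul]; exact hc k hk
  rw [e1, e2, e3] at hs
  simp only [sum_const, card_univ, Fintype.card_fin, nsmul_eq_mul] at e4
  unfold linkBad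
  push_cast at e4
  linarith

/-- Non-rainbow edges touching `W`. -/
lemma sum_touching_bad_le (H : Finset (Finset V)) (χ : V → Fin 3) (W : Finset V) :
    ∑ a, ∑ b, ∑ c, ind ((IsEdge H a b c ∧ ¬ Rainbow χ a b c) ∧ (a ∈ W ∨ b ∈ W ∨ c ∈ W))
      ≤ 3 * ∑ w ∈ W, linkBad H χ w :=
  sum_ind_touching_le W _ fun _ _ _ h =>
    ⟨(isEdge_rotate _ _ _).1 h.1, fun h' => h.2 ((rainbow_rotate _ _ _).2 h')⟩

/-- Non-rainbow edges avoiding `W` and touching a small set `R`. -/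
lemma sum_touching_small_le {s : ℕ} (hs : 2 ≤ s) {H : Finset (Finset V)} {χ : V → Fin 3}
    {W : Finset V} (hK : ∀ v, KssFree s (MonoLink H χ W v)) (R : Finset V) {ρ ζ : ℝ} (hζ : 0 ≤ ζ)
    (hR : (R.card : ℝ) ≤ ρ * Fintype.card V) (h : 2 * (s : ℝ) ^ 2 * ρ ^ (s - 1) ≤ ζ ^ s) :
    ∑ a, ∑ b, ∑ c, ind ((IsEdge H a b c ∧ ¬ Rainbow χ a b c ∧ a ∉ W ∧ b ∉ W ∧ c ∉ W)
        ∧ (a ∈ R ∨ b ∈ R ∨ c ∈ R))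
      ≤ 3 * (2 * s ^ 2 * ρ + 2 * ζ) *
        (Fintype.card V * (Fintype.card V : ℝ) ^ ((2 : ℝ) - 1 / s)) := by
  refine (sum_ind_touching_le R _ ?_).trans ?_
  · rintro a b c ⟨h1, h2, h3, h4, h5⟩
    exact ⟨(isEdge_rotate _ _ _).1 h1, fun h' => h2 ((rainbow_rotate _ _ _).2 h'), h4, h5, h3⟩
  set n := (Fintype.card V : ℝ)
  set z := n ^ ((2 : ℝ) - 1 / s) with hz
  have hz0 : 0 ≤ z := Real.rpow_nonneg (Nat.cast_nonneg _) _
  have pt : ∀ a b c, ind (IsEdge H a b c ∧ ¬ Rainbow χ a b c ∧ a ∉ W ∧ b ∉ W ∧ c ∉ W)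
      ≤ ind (MonoLink H χ W a b c) + ind (MonoLink H χ W c a b) + ind (MonoLink H χ W b a c) := by
    intro a b c
    have t1 := ind_mono (P := IsEdge H a b c ∧ ¬ Rainbow χ a b c ∧ a ∉ W ∧ b ∉ W ∧ c ∉ W)
      (Q := (MonoLink H χ W a b c ∨ MonoLink H χ W c a b) ∨ MonoLink H χ W b a c) (by
        rintro ⟨h1, h2, h3, h4, h5⟩
        have r1 := (isEdge_rotate _ _ _).1 ((isEdge_rotate _ _ _).1 h1)
        have r2 := IsEdge.swap_left _ _ _ h1
        unfold MonoLink
        unfold Rainbow at h2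
        grind)
    have t2 := ind_or_le (MonoLink H χ W a b c ∨ MonoLink H χ W c a b) (MonoLink H χ W b a c)
    have t3 := ind_or_le (MonoLink H χ W a b c) (MonoLink H χ W c a b)
    linarith
  have hsum := sum_le_sum fun a (_ : a ∈ R) => sum_le_sum fun b (_ : b ∈ (univ : Finset V)) =>
    sum_le_sum fun c (_ : c ∈ (univ : Finset V)) => pt a b c
  simp only [sum_add_distrib] at hsum
  have b1 : ∑ a ∈ R, ∑ b, ∑ c, ind (MonoLink H χ W a b c) ≤ ρ * n * (2 * s ^ 2 * z) :=
    calc _ ≤ ∑ _a ∈ R, 2 * (s : ℝ) ^ 2 * z := sum_le_sum fun a _ => (hK a).sum_univ_le hs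
      _ = R.card * (2 * s ^ 2 * z) := by rw [sum_const, nsmul_eq_mul]
      _ ≤ _ := mul_le_mul_of_nonneg_right hR (by positivity)
  have b2 : ∑ a ∈ R, ∑ b, ∑ c, ind (MonoLink H χ W b a c) ≤ n * (ζ * z) := by
    rw [sum_comm]
    calc _ ≤ ∑ _b : V, ζ * z := sum_le_sum fun b _ => (hK b).sum_le hs R hζ hR h
      _ = _ := by rw [sum_const, nsmul_eq_mul, card_univ]
  have b3 : ∑ a ∈ R, ∑ b, ∑ c, ind (MonoLink H χ W c a b) ≤ n * (ζ * z) := by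
    refine le_trans (le_of_eq ?_) b2
    exact sum_congr rfl fun a _ => sum_comm
  linarith

omit [Fintype V] in
lemma card_inside_union_le {s N : ℕ} (hs : 0 < s) (hN : 0 < N) {H : Finset (Finset V)}
    (h3 : ∀ e ∈ H, e.card = 3) {χ : V → Fin 3} {U : Fin 3 → Finset V} (hχ : ∀ i, ∀ x ∈ U i, χ x = i)
    (hU : ∀ i, (U i).card ≤ N) (hK : ∀ i, NoLinkKss s H (U i)) {E : Finset (Finset V)} (hEH : E ⊆ H)
    (hE : ∀ e ∈ E, ¬ Set.InjOn χ (e : Set V) ∧ ∀ x ∈ e, ∃ i, x ∈ U i) :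
    E.card ≤ 6 * exBip N N 1 s + 3 * exThree N (Ktss 1 s) := by
  classical
  let B : Fin 3 × Fin 3 → Finset (Finset V) := fun p =>
    H.filter fun e => ∃ a ∈ U p.1, ∃ b ∈ U p.2, ∃ c ∈ U p.2, b ≠ c ∧ e = {a, b, c}
  have hsub : E ⊆ (univ.biUnion fun i => H.filter (· ⊆ U i)) ∪
        (univ : Finset (Fin 3)).offDiag.biUnion B := by
    intro e he
    have heH := hEH he
    obtain ⟨hinj, heU⟩ := hE e he
    have hU' : ∀ x ∈ e, x ∈ U (χ x) := by
      intro x hx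
      obtain ⟨i, hi⟩ := heU x hx
      rwa [hχ i x hi]
    unfold Set.InjOn at hinj
    push Not at hinj
    obtain ⟨b, hb, c, hc, hbc, hne⟩ := hinj
    rw [mem_coe] at hb hc
    have hsub : ({b, c} : Finset V) ⊆ e := by
      intro x hx
      rcases mem_insert.1 hx with rfl | hx
      · exact hb
      · rwa [mem_singleton.1 hx]
    obtain ⟨a, ha⟩ : ∃ a, e \ {b, c} = {a} := by
      rw [← card_eq_one, card_sdiff_of_subset hsub, h3 e heH, card_pair hne]
    have hea : e = {a, b, c} := by
      rw [← sdiff_union_of_subset hsub, ha]; rfl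
    have hae : a ∈ e := by simp [hea]
    have hcb : c ∈ U (χ b) := hbc ▸ hU' c hc
    rw [mem_union]
    by_cases hab : χ a = χ b
    · left
      refine mem_biUnion.2 ⟨χ b, mem_univ _, mem_filter.2 ⟨heH, ?_⟩⟩
      rw [hea]
      simp only [insert_subset_iff, singleton_subset_iff]
      exact ⟨hab ▸ hU' a hae, hU' b hb, hcb⟩
    · right
      refine mem_biUnion.2 ⟨(χ a, χ b), by simpa using hab, mem_filter.2 ⟨heH, ?_⟩⟩
      exact ⟨a, hU' a hae, b, hU' b hb, c, hcb, hne, hea⟩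
  refine (card_le_card hsub).trans ((card_union_le _ _).trans ?_)
  rw [add_comm]
  refine add_le_add ?_ ?_
  · refine card_biUnion_le.trans ?_
    calc _ ≤ ∑ _p ∈ (univ : Finset (Fin 3)).offDiag, exBip N N 1 s := by
          refine sum_le_sum fun p hp => ?_
          have hp' : p.1 ≠ p.2 := by simpa using hp
          refine card_bip_le hs hN (U := U p.1) (W := U p.2) ?_ (hU _) (hU _) (hK _)
            (filter_subset _ _) fun e he => (mem_filter.1 he).2
          exact disjoint_left.2 fun x h1 h2 => hp' ((hχ _ x h1).symm.trans (hχ _ x h2))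
      _ = _ := by rw [sum_const, smul_eq_mul]; rfl
  · refine card_biUnion_le.trans ?_
    calc _ ≤ ∑ _i : Fin 3, exThree N (Ktss 1 s) :=
          sum_le_sum fun i _ => card_inside_le hs hN h3 (hU i) (hK i)
      _ = _ := by simp

end Assembly

lemma sum_reorder_five {V : Type*} [Fintype V] (F : V → V → V → V → V → ℝ) :
    ∑ p, ∑ q, ∑ w, ∑ x, ∑ y, F p q w x y = ∑ w, ∑ y, ∑ q, ∑ p, ∑ x, F p q w x y := by
  rw [← sum_rotate fun p q w => ∑ x, ∑ y, F p q w x y]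
  refine sum_congr rfl fun w _ => ?_
  rw [sum_comm, sum_rotate fun q p y => ∑ x, F p q w x y]
  exact sum_congr rfl fun q _ => sum_congr rfl fun p _ => sum_comm

section Main

variable {V : Type} [Fintype V] [DecidableEq V]

/-- A dense `F`-free 3-graph has a colouring of maximum cut which captures almost all edges. -/
lemma exists_maximal_colouring (m s : ℕ) (hs : 2 ≤ s) (hm : 2 * s ≤ m) {δ : ℝ} (hδ : 0 < δ) :
    ∃ K : ℕ, ∀ (V : Type) [Fintype V] [DecidableEq V] [Nonempty V] (H : Finset (Finset V)),
      (∀ e ∈ H, e.card = 3) → ¬ HasCopy H (F5Stss m 1 s hm) → K ≤ Fintype.card V →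
      2 / 9 * (Fintype.card V : ℝ) ^ 3 ≤ 6 * (H.card : ℝ) →
      ∃ χ : V → Fin 3, (∀ χ', cutSize H χ' ≤ cutSize H χ) ∧
        (2 / 9 - δ) * (Fintype.card V : ℝ) ^ 3 ≤ cutSize H χ := by
  obtain ⟨κ, hκ, hst⟩ := stability hδ
  obtain ⟨K, hK⟩ := exists_hasCopy_of_dense_F5 m s hs hm κ hκ
  refine ⟨K, fun V _ _ _ H h3 hF hn hd => ?_⟩
  have hT : 2 / 9 * (Fintype.card V : ℝ) ^ 3 ≤ ∑ a, ∑ b, ∑ c, ind (IsEdge H a b c) :=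
    hd.trans (six_mul_card_le h3)
  obtain ⟨χ₀, hχ₀⟩ := hst V (IsEdge H) IsEdge.swap_left IsEdge.swap_right (by
    by_contra! hlt
    refine hF (hK V H univ h3 (by rwa [card_univ]) ?_)
    rw [card_univ]
    refine (le_of_eq (by ring)).trans (hlt.le.trans (le_of_eq ?_))
    rw [sum_reorder_five]
    refine sum_congr rfl fun w _ => sum_congr rfl fun y _ => sum_congr rfl fun q _ =>
      sum_congr rfl fun p _ => sum_congr rfl fun x _ => ?_
    rw [← ind_and, ← ind_and, and_assoc]
    rfl) hT
  obtain ⟨χ, hχ⟩ := Finite.exists_max (cutSize H)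
  refine ⟨χ, hχ, le_trans ?_ (hχ χ₀)⟩
  have hsplit : ∑ a, ∑ b, ∑ c, ind (IsEdge H a b c)
      = cutSize H χ₀ + ∑ a, ∑ b, ∑ c, ind (IsEdge H a b c ∧ ¬ Rainbow χ₀ a b c) := by
    unfold cutSize
    simp only [← sum_add_distrib]
    refine sum_congr rfl fun a _ => sum_congr rfl fun b _ => sum_congr rfl fun c _ => ?_
    rw [ind_and, ind_and, ind_not]; ring
  linarith

omit [Fintype V] in
lemma exists_subset_card_sdiff_le (G : Finset V) (N : ℕ) {r : ℝ} (hr : 0 ≤ r)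
    (hG : (G.card : ℝ) ≤ N + r) : ∃ U ⊆ G, U.card ≤ N ∧ ((G \ U).card : ℝ) ≤ r := by
  rcases le_total G.card N with h | h
  · exact ⟨G, Subset.rfl, h, by simpa using hr⟩
  · obtain ⟨U, hU, hUN⟩ := exists_subset_card_eq h
    refine ⟨U, hU, hUN.le, ?_⟩
    rw [card_sdiff_of_subset hU, hUN, Nat.cast_sub h]
    linarith

/-- Edge count of a 3-graph all of whose links have no monochromatic `K_{s,s}` outside `W`. -/
lemma six_mul_card_le_of_kssFree {s N : ℕ} (hs : 2 ≤ s) (hN : 0 < N) {H : Finset (Finset V)}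
    (h3 : ∀ e ∈ H, e.card = 3) {χ : V → Fin 3} {W : Finset V}
    (hK : ∀ v, KssFree s (MonoLink H χ W v)) {ρ ζ : ℝ} (hρ : 0 ≤ ρ) (hζ : 0 ≤ ζ)
    (hcl : ∀ i, ((univ.filter fun x => χ x = i).card : ℝ) ≤ N + ρ / 3 * Fintype.card V)
    (h : 2 * (s : ℝ) ^ 2 * ρ ^ (s - 1) ≤ ζ ^ s) :
    6 * (H.card : ℝ) ≤ cutSize H χ + 3 * ∑ w ∈ W, linkBad H χ w
      + 3 * (2 * s ^ 2 * ρ + 2 * ζ) * (Fintype.card V * (Fintype.card V : ℝ) ^ ((2 : ℝ) - 1 / s))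
      + 6 * (6 * exBip N N 1 s + 3 * exThree N (Ktss 1 s)) := by
  classical
  have hU : ∀ i : Fin 3, ∃ U ⊆ univ.filter (fun x => χ x = i ∧ x ∉ W), U.card ≤ N ∧
      ((univ.filter (fun x => χ x = i ∧ x ∉ W) \ U).card : ℝ) ≤ ρ / 3 * Fintype.card V := by
    intro i
    refine exists_subset_card_sdiff_le _ N (by positivity) (le_trans ?_ (hcl i))
    exact_mod_cast card_le_card fun x hx => by
      simp only [mem_filter, mem_univ, true_and] at hx ⊢; exact hx.1
  choose U hUG hUN hUr using hU
  have hUG' : ∀ i, ∀ x ∈ U i, χ x = i ∧ x ∉ W := fun i x hx => by simpa using hUG i hx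
  set R : Finset V := univ.biUnion fun i => univ.filter (fun x => χ x = i ∧ x ∉ W) \ U i with hRdef
  have hR : (R.card : ℝ) ≤ ρ * Fintype.card V := by
    calc (R.card : ℝ) ≤ ∑ i, ((univ.filter (fun x => χ x = i ∧ x ∉ W) \ U i).card : ℝ) := by
          exact_mod_cast card_biUnion_le
      _ ≤ ∑ _i : Fin 3, ρ / 3 * (Fintype.card V : ℝ) := sum_le_sum fun i _ => hUr i
      _ = _ := by simp; ring
  have hcover : ∀ x, (∃ i, x ∈ U i) ∨ x ∈ W ∨ x ∈ R := by
    intro x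
    by_cases hx : x ∈ W
    · exact .inr (.inl hx)
    by_cases hxU : x ∈ U (χ x)
    · exact .inl ⟨_, hxU⟩
    · refine .inr (.inr ?_)
      simp [hRdef, hx, hxU]
  have hlink : ∀ i, NoLinkKss s H (U i) := by
    intro i v α β hα hβ hαU hβU hA
    exact hK v α β hα hβ fun j k => ⟨hA j k, (hUG' i _ (hαU j)).1.trans (hUG' i _ (hβU k)).1.symm,
      (hUG' i _ (hαU j)).2, (hUG' i _ (hβU k)).2⟩
  set A := H.filter fun e : Finset V => Set.InjOn χ (e : Set V) with hA
  set B := H.filter fun e : Finset V => ¬ Set.InjOn χ (e : Set V) ∧ ∀ x ∈ e, ∃ i, x ∈ U i with hB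
  set C := H.filter fun e : Finset V => ¬ Set.InjOn χ (e : Set V) ∧ ¬ ∀ x ∈ e, ∃ i, x ∈ U i with hC
  have hcard : H.card ≤ A.card + B.card + C.card := by
    have : H ⊆ A ∪ B ∪ C := by
      intro e he
      simp only [hA, hB, hC, mem_union, mem_filter, he, true_and]
      tauto
    exact (card_le_card this).trans ((card_union_le _ _).trans
      (Nat.add_le_add_right (card_union_le _ _) _))
  have hinj : ∀ a b c, ({a, b, c} : Finset V) ∈ H →
      (Set.InjOn χ (({a, b, c} : Finset V) : Set V) ↔ Rainbow χ a b c) := by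
    intro a b c hE
    obtain ⟨hab, hac, hbc⟩ := distinct_of_card_three (h3 _ hE)
    simp only [coe_insert, coe_singleton]
    constructor
    · intro hi
      exact ⟨fun he => hab (hi (by simp) (by simp) he), fun he => hac (hi (by simp) (by simp) he),
        fun he => hbc (hi (by simp) (by simp) he)⟩
    · rintro ⟨h1, h2, h3⟩ x hx y hy hxy
      simp only [Set.mem_insert_iff, Set.mem_singleton_iff] at hx hy
      grind
  have hAc : 6 * (A.card : ℝ) ≤ cutSize H χ := by
    refine (six_mul_card_le fun e he => h3 e (filter_subset _ _ he)).trans ?_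
    refine sum_le_sum fun a _ => sum_le_sum fun b _ => sum_le_sum fun c _ => ind_mono fun he => ?_
    obtain ⟨h1, h2⟩ := mem_filter.1 he
    exact ⟨h1, (hinj a b c h1).1 h2⟩
  have hBc : B.card ≤ 6 * exBip N N 1 s + 3 * exThree N (Ktss 1 s) :=
    card_inside_union_le (by omega) hN h3 (fun i x hx => (hUG' i x hx).1) hUN hlink
      (filter_subset _ _) fun e he => (mem_filter.1 he).2
  have hCc : 6 * (C.card : ℝ) ≤ 3 * ∑ w ∈ W, linkBad H χ w
      + 3 * (2 * s ^ 2 * ρ + 2 * ζ)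
        * (Fintype.card V * (Fintype.card V : ℝ) ^ ((2 : ℝ) - 1 / s)) := by
    refine (six_mul_card_le fun e he => h3 e (filter_subset _ _ he)).trans (le_trans ?_
      (add_le_add (sum_touching_bad_le H χ W) (sum_touching_small_le hs hK R hζ hR h)))
    simp only [← sum_add_distrib]
    refine sum_le_sum fun a _ => sum_le_sum fun b _ => sum_le_sum fun c _ =>
      (ind_mono fun he => ?_).trans (ind_or_le _ _)
    obtain ⟨h1, h2, h4⟩ := mem_filter.1 he
    have hr : ¬ Rainbow χ a b c := fun hr => h2 ((hinj a b c h1).2 hr)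
    have hE : IsEdge H a b c := h1
    by_cases hW : a ∈ W ∨ b ∈ W ∨ c ∈ W
    · exact .inl ⟨⟨hE, hr⟩, hW⟩
    push Not at hW
    refine .inr ⟨⟨hE, hr, hW⟩, ?_⟩
    push Not at h4
    obtain ⟨x, hx, hxU⟩ := h4
    simp only [mem_insert, mem_singleton] at hx
    rcases hx with rfl | rfl | rfl
    · exact .inl (((hcover x).resolve_left (by simpa using hxU)).resolve_left hW.1)
    · exact .inr (.inl (((hcover x).resolve_left (by simpa using hxU)).resolve_left hW.2.1))
    · exact .inr (.inr (((hcover x).resolve_left (by simpa using hxU)).resolve_left hW.2.2))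
  have hBc' : (B.card : ℝ) ≤ 6 * exBip N N 1 s + 3 * exThree N (Ktss 1 s) := by exact_mod_cast hBc
  have hcard' : (H.card : ℝ) ≤ A.card + B.card + C.card := by exact_mod_cast hcard
  linarith

/-- The exceptional vertices contribute few non-rainbow edges. -/
lemma three_mul_sum_linkBad_le {H : Finset (Finset V)} {χ : V → Fin 3} {W X : Finset V} {η γ z : ℝ}
    {K : ℕ} (hη : 0 ≤ η) (hγ : 0 ≤ γ) (hγη : 36 * γ ≤ η)
    (hW : ∀ w ∈ W, η * (Fintype.card V : ℝ) ^ 2 ≤ missing H χ w)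
    (hWc : (W.card : ℝ) ≤ η / 24 * Fintype.card V)
    (hXK : X.card ≤ K)
    (hX : ∀ w ∉ X, ∀ k, k ≠ χ w → linkCut H χ w k ≤ γ * (Fintype.card V : ℝ) ^ 2)
    (hz : z ≤ η / 12 * (Fintype.card V : ℝ) ^ 2)
    (hmono : ∀ w, ∑ x, ∑ y, ind (MonoLink H χ W w x y) ≤ z) :
    3 * ∑ w ∈ W, linkBad H χ w ≤ 3 * K * (Fintype.card V : ℝ) ^ 2 + ∑ x, missing H χ x := by
  set n : ℝ := (Fintype.card V : ℝ)
  have hn : 0 ≤ n := Nat.cast_nonneg _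
  have pt : ∀ w ∈ W, 3 * linkBad H χ w ≤ 3 * n ^ 2 * ind (w ∈ X) + missing H χ w := by
    intro w hw
    by_cases hwX : w ∈ X
    · rw [ind_of hwX]
      have := linkBad_le H χ w
      have := missing_nonneg H χ w
      linarith
    · rw [ind_of_not hwX]
      have h1 := linkBad_le_of_linkCut_le W w (by positivity) (hX w hwX)
      have h2 := hmono w
      have h4 := hW w hw
      have h5 := mul_le_mul_of_nonneg_right hWc hn
      have h9 := mul_nonneg hη (sq_nonneg n)
      have h6 := mul_le_mul_of_nonneg_right hγη (sq_nonneg n)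
      change linkBad H χ w ≤ 2 * (W.card * n) + _ + _ at h1
      linarith
  have hX' : ∑ w ∈ W, ind (w ∈ X) ≤ K := by
    rw [sum_ind_eq_card]
    exact_mod_cast (card_le_card fun x hx => (mem_filter.1 hx).2).trans hXK
  have hs := sum_le_sum pt
  rw [sum_add_distrib, ← mul_sum, ← mul_sum] at hs
  have h7 : ∑ w ∈ W, missing H χ w ≤ ∑ w, missing H χ w :=
    sum_le_sum_of_subset_of_nonneg (subset_univ _) fun x _ _ => missing_nonneg H χ x
  have h8 := mul_le_mul_of_nonneg_left hX' (by positivity : 0 ≤ 3 * n ^ 2)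
  linarith

end Main

lemma exists_small_parameters {s : ℕ} (hs : 2 ≤ s) {ε : ℝ} (hε : 0 < ε) :
    ∃ ρ ζ : ℝ, 0 < ρ ∧ 0 < ζ ∧ 2 * (s : ℝ) ^ 2 * ρ + 2 * ζ ≤ ε ∧
      2 * (s : ℝ) ^ 2 * ρ ^ (s - 1) ≤ ζ ^ s := by
  have hs0 : (0 : ℝ) < 2 * (s : ℝ) ^ 2 := by positivity
  refine ⟨min 1 (min (ε / 2 / (2 * (s : ℝ) ^ 2)) ((ε / 4) ^ s / (2 * (s : ℝ) ^ 2))), ε / 4,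
    by positivity, by positivity, ?_, ?_⟩
  · have := (le_div_iff₀' hs0).1 ((min_le_right 1 (min (ε / 2 / (2 * (s : ℝ) ^ 2))
      ((ε / 4) ^ s / (2 * (s : ℝ) ^ 2)))).trans (min_le_left _ _))
    linarith
  · refine (le_div_iff₀' hs0).1 ((pow_le_of_le_one (by positivity) (min_le_left _ _)
      (by omega)).trans ((min_le_right _ _).trans (min_le_right _ _)))

lemma exists_forall_rpow_ge {a : ℝ} (ha : 0 < a) (B : ℝ) : ∃ n₀ : ℕ, ∀ n : ℕ, n₀ ≤ n →
    B ≤ (n : ℝ) ^ a :=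
  Filter.eventually_atTop.1 (((tendsto_rpow_atTop ha).comp tendsto_natCast_atTop_atTop).eventually_ge_atTop B)

lemma card_le_of_large (m s : ℕ) (hs : 2 ≤ s) (hm : 2 * s ≤ m) (ε : ℝ) (hε : 0 < ε) :
    ∃ N₀ : ℕ, ∀ N : ℕ, N₀ ≤ N → ∀ H : Finset (Finset (Fin (3 * N))), (∀ e ∈ H, e.card = 3) →
      ¬ HasCopy H (F5Stss m 1 s hm) → N ^ 3 ≤ H.card →
      (H.card : ℝ) ≤ (N : ℝ) ^ 3 + 6 * exBip N N 1 s + 3 * exThree N (Ktss 1 s)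
        + ε * ((3 * N : ℕ) : ℝ) ^ ((3 : ℝ) - 1 / (s : ℝ)) := by
  obtain ⟨ρ, ζ, hρ, hζ, hρζ, hρs⟩ := exists_small_parameters hs hε
  have hs0 : (0 : ℝ) < s := by exact_mod_cast (by omega : 0 < s)
  set η : ℝ := 1 / (100 * s) with hη
  have hη0 : 0 < η := by positivity
  set γ : ℝ := η / 36 with hγ
  have hγ0 : 0 < γ := by positivity
  obtain ⟨δ, hδ0, hδ1, hδ2, hδ3, hδ4⟩ : ∃ δ : ℝ, 0 < δ ∧ 2 * δ ≤ (ρ / 3) ^ 2 ∧ δ ≤ γ ^ 2 / 4 ∧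
      δ ≤ η ^ 2 / 24 ∧ δ ≤ 1 / 1000 := by
    refine ⟨min ((ρ / 3) ^ 2 / 2) (min (γ ^ 2 / 4) (min (η ^ 2 / 24) (1 / 1000))),
      by positivity, ?_, ?_, ?_, ?_⟩
    · linarith [min_le_left ((ρ / 3) ^ 2 / 2) (min (γ ^ 2 / 4) (min (η ^ 2 / 24) (1 / 1000)))]
    · exact (min_le_right _ _).trans (min_le_left _ _)
    · exact (min_le_right _ _).trans ((min_le_right _ _).trans (min_le_left _ _))
    · exact (min_le_right _ _).trans ((min_le_right _ _).trans (min_le_right _ _))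
  obtain ⟨K₁, hK₁⟩ := exists_maximal_colouring m s hs hm hδ0
  obtain ⟨K₂, hK₂⟩ := exists_hasCopy_of_dense_F5 m s hs hm (γ ^ 2 / 4) (by positivity)
  obtain ⟨K₃, hK₃⟩ := exists_hasCopy_of_dense_link m s hs hm (1 / 100) (by norm_num)
  have hs1 : (1 : ℝ) / s < 1 := by
    rw [div_lt_one hs0]; exact_mod_cast (by omega : 1 < s)
  obtain ⟨n₁, hn₁⟩ := exists_forall_rpow_ge (show 0 < (1 : ℝ) / s by positivity)
    (24 * (s : ℝ) ^ 2 / η)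
  obtain ⟨n₂, hn₂⟩ := exists_forall_rpow_ge (show 0 < 1 - (1 : ℝ) / s by linarith) (K₂ / ε)
  refine ⟨K₁ + K₃ + n₁ + n₂ + 200, fun N hN H h3 hF hd => ?_⟩
  have : Nonempty (Fin (3 * N)) := ⟨⟨0, by omega⟩⟩
  have hcard : Fintype.card (Fin (3 * N)) = 3 * N := Fintype.card_fin _
  set n : ℝ := ((3 * N : ℕ) : ℝ) with hn
  have hn3 : n = 3 * N := by rw [hn]; push_cast; ring
  have hnpos : 0 < n := by rw [hn]; exact_mod_cast (by omega : 0 < 3 * N)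
  have hd' : (N : ℝ) ^ 3 ≤ H.card := by exact_mod_cast hd
  obtain ⟨χ, hmax, hcut⟩ := hK₁ (Fin (3 * N)) H h3 hF (by rw [hcard]; omega) (by
    rw [hcard, ← hn, hn3]; linarith)
  rw [hcard, ← hn] at hcut
  have hM := sum_missing H χ
  have hcp := classProd_le χ
  rw [hcard, ← hn] at hcp
  have hMle : ∑ x, missing H χ x ≤ δ * n ^ 3 := by linarith
  have hM0 : 0 ≤ ∑ x, missing H χ x := sum_nonneg fun x _ => missing_nonneg H χ x
  have hp : (2 / 9 - δ) * n ^ 3 ≤ 6 * classProd χ := by linarith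
  classical
  set W := univ.filter fun x => η * n ^ 2 < missing H χ x with hWdef
  have hWin : ∀ w ∈ W, η * n ^ 2 ≤ missing H χ w := fun w hw => (mem_filter.1 hw).2.le
  have hWout : ∀ x ∉ W, s * missing H χ x ≤ 1 / 100 * n ^ 2 := by
    intro x hx
    have h1 : missing H χ x ≤ η * n ^ 2 := by simpa [hWdef] using hx
    calc s * missing H χ x ≤ s * (η * n ^ 2) := by gcongr
      _ = _ := by rw [hη]; field_simp
  have hWc : (W.card : ℝ) ≤ η / 24 * n := by
    have h1 : W.card * (η * n ^ 2) ≤ δ * n ^ 3 := by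
      calc W.card * (η * n ^ 2) = ∑ _w ∈ W, η * n ^ 2 := by rw [sum_const, nsmul_eq_mul]
        _ ≤ ∑ w ∈ W, missing H χ w := sum_le_sum hWin
        _ ≤ ∑ w, missing H χ w :=
          sum_le_sum_of_subset_of_nonneg (subset_univ _) fun x _ _ => missing_nonneg H χ x
        _ ≤ _ := hMle
    have h2 : δ * n ^ 3 ≤ η ^ 2 / 24 * n ^ 3 := by gcongr
    have h4 : 0 < η * n ^ 2 := by positivity
    refine le_of_mul_le_mul_right ?_ h4
    linarith
  have hKss : ∀ v, KssFree s (MonoLink H χ W v) := fun v =>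
    kssFree_monoLink hs hm hF hδ4 (by rw [hcard]; omega) (by rwa [hcard, ← hn])
      (by rwa [hcard, ← hn]) (by rwa [hcard, ← hn]) v
      fun α β hα hβ hE => hK₃ _ H v α β (by rw [hcard]; omega) h3 hα hβ hE
  set X := univ.filter fun w => ∃ k, k ≠ χ w ∧ γ * n ^ 2 ≤ linkCut H χ w k with hXdef
  have hXc : X.card < K₂ := by
    refine card_movable_lt hm h3 hF hmax hγ0.le hδ2 (by rwa [hcard, ← hn]) (hK₂ _ H · h3) X ?_
    intro w hw
    rw [hcard, ← hn]
    exact (mem_filter.1 hw).2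
  have hXout : ∀ w ∉ X, ∀ k, k ≠ χ w → linkCut H χ w k ≤ γ * n ^ 2 := by
    intro w hw k hk
    by_contra! hlt
    exact hw (mem_filter.2 ⟨mem_univ _, k, hk, hlt.le⟩)
  set z := n ^ ((2 : ℝ) - 1 / s) with hz
  have hzη : 2 * (s : ℝ) ^ 2 * z ≤ η / 12 * n ^ 2 := by
    have h1 := (div_le_iff₀ hη0).1 (hn₁ (3 * N) (by omega))
    rw [← hn] at h1
    have h2 : z * n ^ ((1 : ℝ) / s) = n ^ 2 := by
      rw [hz, ← Real.rpow_add hnpos, sub_add_cancel, Real.rpow_ofNat]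
    have h4 : 0 ≤ z := by positivity
    have h5 := mul_le_mul_of_nonneg_left h1 h4
    have h6 : z * (n ^ ((1 : ℝ) / s) * η) = n ^ 2 * η := by rw [← mul_assoc, h2]
    linarith
  have hbad := three_mul_sum_linkBad_le (H := H) (χ := χ) (W := W) (X := X) hη0.le hγ0.le
    (by rw [hγ]; linarith) (by rwa [hcard, ← hn]) (by rwa [hcard, ← hn]) hXc.le
    (by rwa [hcard, ← hn]) (z := 2 * (s : ℝ) ^ 2 * z) (by rwa [hcard, ← hn])
    (fun w => by simpa only [hcard, ← hn, ← hz] using (hKss w).sum_univ_le hs)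
  have hmain := six_mul_card_le_of_kssFree (N := N) hs (by omega) h3 hKss hρ.le hζ.le
    (fun i => by
      have := class_card_le (χ := χ) (δ := δ) (show 0 ≤ ρ / 3 by positivity) hδ1
        (by rwa [hcard, ← hn]) i
      rw [hcard, ← hn] at this ⊢
      linarith) hρs
  rw [hcard, ← hn] at hbad hmain
  have hnz : n * z = n ^ ((3 : ℝ) - 1 / s) := by
    rw [hz]
    nth_rewrite 1 [← Real.rpow_one n]
    rw [← Real.rpow_add hnpos]
    congr 1; ring
  have hnz2 : n ^ ((3 : ℝ) - 1 / s) = n ^ 2 * n ^ (1 - (1 : ℝ) / s) := by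
    rw [← Real.rpow_ofNat, ← Real.rpow_add hnpos]
    congr 1; ring
  have hK2 : K₂ * n ^ 2 ≤ ε * n ^ ((3 : ℝ) - 1 / s) := by
    have h1 := (div_le_iff₀ hε).1 (hn₂ (3 * N) (by omega))
    rw [← hn] at h1
    rw [hnz2]
    nlinarith [mul_le_mul_of_nonneg_right h1 (sq_nonneg n)]
  rw [← hz, hnz] at hmain
  have hlast := mul_le_mul_of_nonneg_right hρζ
    (show 0 ≤ n ^ ((3 : ℝ) - 1 / s) by positivity)
  have hn27 : n ^ 3 = 27 * (N : ℝ) ^ 3 := by rw [hn3]; ring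
  linarith

theorem statement4 (m s : ℕ) (hs : 2 ≤ s) (hm : 2*s ≤ m)
    (ε : ℝ) (hε : 0 < ε) :
    ∃ n0 : ℕ, ∀ n : ℕ, n ≥ n0 → 3 ∣ n →
    (exThree n (F5Stss m 1 s hm) : ℝ) ≤
      ((T3 n).card : ℝ) + 6 * (exBip (n/3) (n/3) 1 s : ℝ) + 3 * (exThree (n/3) (Ktss 1 s) : ℝ)
        + ε * (n : ℝ) ^ ((3 : ℝ) - 1/(s : ℝ)) := by
  obtain ⟨N₀, hN₀⟩ := card_le_of_large m s hs hm ε hε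
  refine ⟨3 * N₀, ?_⟩
  rintro _ hn ⟨N, rfl⟩
  rw [Nat.mul_div_cancel_left N (by norm_num)]
  have hT : (N : ℝ) ^ 3 ≤ (T3 (3 * N)).card := by exact_mod_cast pow_three_le_card_T3 N
  refine exThree_le (by positivity) fun H h3 hF => ?_
  rcases le_total (N ^ 3) H.card with hd | hd
  · linarith [hN₀ N (by omega) H h3 hF hd]
  · have hd' : (H.card : ℝ) ≤ (N : ℝ) ^ 3 := by exact_mod_cast hd
    have h1 : (0 : ℝ) ≤ 6 * exBip N N 1 s + 3 * exThree N (Ktss 1 s) := by positivity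
    have h2 : 0 ≤ ε * ((3 * N : ℕ) : ℝ) ^ ((3 : ℝ) - 1 / (s : ℝ)) := by positivity
    linarith
end

section
/- Let t ≥ 1 and m ≥ 2s ≥ 4 be integers and let n ≥ 3. Let H be any 3-graph obtained from T_3(n,3) by adding, inside each of the three parts, an arbitrary 3-graph on that part containing no copy of K_{t,s,s}. Then H contains no copy of F_5^S(m,t,K_{s,s}). -/
open Finset

/-- The image of a three-element set under a function. -/
theorem image_triple {α β : Type*} [DecidableEq α] [DecidableEq β] (f : α → β) (x y z : α) :
    ({x, y, z} : Finset α).image f = {f x, f y, f z} := by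
  simp [Finset.image_insert]

/-- Three vertices with pairwise distinct residues mod 3 form a hyperedge of `T3 n`. -/
theorem triple_mem_T3 {n : ℕ} {x y z : Fin n} (hx : (x : ℕ) % 3 = 0) (hy : (y : ℕ) % 3 = 1)
    (hz : (z : ℕ) % 3 = 2) : ({x, y, z} : Finset (Fin n)) ∈ T3 n := by
  have hxy : x ≠ y := by rintro rfl; omega
  have hxz : x ≠ z := by rintro rfl; omega
  have hyz : y ≠ z := by rintro rfl; omega
  simp only [T3, Finset.mem_filter, Finset.mem_univ, true_and]
  refine ⟨Finset.card_eq_three.2 ⟨x, y, z, hxy, hxz, hyz, rfl⟩, fun i => ?_⟩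
  rw [Finset.card_eq_one]
  fin_cases i
  · refine ⟨x, ?_⟩
    ext v
    simp only [turanPart, Finset.mem_inter, Finset.mem_insert, Finset.mem_singleton,
      Finset.mem_filter, Finset.mem_univ, true_and]
    grind
  · refine ⟨y, ?_⟩
    ext v
    simp only [turanPart, Finset.mem_inter, Finset.mem_insert, Finset.mem_singleton,
      Finset.mem_filter, Finset.mem_univ, true_and]
    grind
  · refine ⟨z, ?_⟩
    ext v
    simp only [turanPart, Finset.mem_inter, Finset.mem_insert, Finset.mem_singleton,
      Finset.mem_filter, Finset.mem_univ, true_and]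
    grind

/-- Distinct vertices of a hyperedge of `T3 n` have distinct residues mod 3. -/
theorem mod_three_ne_of_mem_T3 {n : ℕ} {e : Finset (Fin n)} (he : e ∈ T3 n) {x y : Fin n}
    (hx : x ∈ e) (hy : y ∈ e) (hxy : x ≠ y) : (x : ℕ) % 3 ≠ (y : ℕ) % 3 := by
  intro h
  simp only [T3, Finset.mem_filter, Finset.mem_univ, true_and] at he
  have hcard := (he.2 ⟨(x : ℕ) % 3, Nat.mod_lt _ (by norm_num)⟩).le
  rw [Finset.card_le_one] at hcard
  exact hxy (hcard x (by simp [turanPart, hx]) y (by simp [turanPart, hy, h]))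

/-- If every hyperedge is in `T3 n` or inside a part, then the vertices of a hyperedge have
either all equal or pairwise distinct residues mod 3. -/
theorem mod_three_eq_or_ne {n : ℕ} {H : Finset (Finset (Fin n))}
    (hedges : ∀ e ∈ H, e ∈ T3 n ∨ (e.card = 3 ∧ ∃ i : Fin 3, e ⊆ turanPart n i))
    {x y z : Fin n} (hxy : x ≠ y) (hxz : x ≠ z) (hyz : y ≠ z)
    (he : ({x, y, z} : Finset (Fin n)) ∈ H) :
    ((x : ℕ) % 3 = (y : ℕ) % 3 ∧ (y : ℕ) % 3 = (z : ℕ) % 3) ∨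
    ((x : ℕ) % 3 ≠ (y : ℕ) % 3 ∧ (x : ℕ) % 3 ≠ (z : ℕ) % 3 ∧ (y : ℕ) % 3 ≠ (z : ℕ) % 3) := by
  rcases hedges _ he with h | ⟨-, i, hi⟩
  · exact Or.inr ⟨mod_three_ne_of_mem_T3 h (by simp) (by simp) hxy,
      mod_three_ne_of_mem_T3 h (by simp) (by simp) hxz,
      mod_three_ne_of_mem_T3 h (by simp) (by simp) hyz⟩
  · simp only [turanPart, Finset.insert_subset_iff, Finset.singleton_subset_iff,
      Finset.mem_filter, Finset.mem_univ, true_and] at hi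
    left
    omega

theorem statement5 (m t s : ℕ) (ht : 1 ≤ t) (hs : 2 ≤ s) (hm : 2*s ≤ m)
    (n : ℕ) (hn : 3 ≤ n) (H : Finset (Finset (Fin n)))
    (hsub : T3 n ⊆ H)
    (hedges : ∀ e ∈ H, e ∈ T3 n ∨ (e.card = 3 ∧ ∃ i : Fin 3, e ⊆ turanPart n i))
    (hfree : ∀ i : Fin 3, ¬ HasCopy (H.filter (fun e => e ⊆ turanPart n i)) (Ktss t s)) :
    ¬ HasCopy H (F5Stss m t s hm) := by
  rintro ⟨f, hf⟩
  have hmod : ∀ {x y z : Fin (3 * m) ⊕ Fin t}, x ≠ y → x ≠ z → y ≠ z →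
      ({x, y, z} : Finset _) ∈ F5Stss m t s hm → _ := fun {x y z} hxy hxz hyz he =>
    mod_three_eq_or_ne hedges (f.injective.ne hxy) (f.injective.ne hxz) (f.injective.ne hyz)
      (image_triple f x y z ▸ hf _ he)
  let b : Fin (3 * m) := ⟨1, by omega⟩
  let c : Fin (3 * m) := ⟨2, by omega⟩
  have hbc : b ≠ c := by simp [b, c]
  have hpart : ∀ x y : Fin (3 * m), (x : ℕ) % 3 = 0 → (y : ℕ) % 3 = 0 →
      (f (Sum.inl x) : ℕ) % 3 = (f (Sum.inl y) : ℕ) % 3 := by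
    have hmem : ∀ x : Fin (3 * m), (x : ℕ) % 3 = 0 →
        ({Sum.inl x, Sum.inl b, Sum.inl c} : Finset (Fin (3 * m) ⊕ Fin t)) ∈
          F5Stss m t s hm := fun x hx =>
      Finset.mem_union_left _ (Finset.mem_image.2
        ⟨{x, b, c}, triple_mem_T3 hx rfl rfl, image_triple _ _ _ _⟩)
    have key : ∀ x : Fin (3 * m), (x : ℕ) % 3 = 0 → _ := fun x hx =>
      hmod (by rintro h; cases h; simp [b] at hx) (by rintro h; cases h; simp [c] at hx)
        (by simpa using hbc) (hmem x hx)
    intro x y hx hy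
    have h1 := key x hx
    have h2 := key y hy
    omega
  let p : Fin s → Fin (3 * m) := fun i => ⟨3 * i.val, by omega⟩
  let q : Fin s → Fin (3 * m) := fun i => ⟨3 * (s + i.val), by omega⟩
  have hpq : ∀ i j, p i ≠ q j := by
    intro i j h
    simp only [p, q, Fin.mk.injEq] at h
    omega
  have hT : ∀ (j : Fin t) (i k : Fin s),
      ({Sum.inr j, Sum.inl (p i), Sum.inl (q k)} : Finset (Fin (3 * m) ⊕ Fin t)) ∈
        F5Stss m t s hm := by
    intro j i k
    refine Finset.mem_union_right _ (Finset.mem_biUnion.2 ⟨j, Finset.mem_univ _,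
      Finset.mem_image.2 ⟨(p i, q k), Finset.mem_product.2 ⟨?_, ?_⟩, rfl⟩⟩)
    · exact Finset.mem_image_of_mem p (Finset.mem_univ i)
    · exact Finset.mem_image_of_mem q (Finset.mem_univ k)
  let o : Fin s := ⟨0, by omega⟩
  have hp : ∀ i, (f (Sum.inl (p i)) : ℕ) % 3 = (f (Sum.inl (p o)) : ℕ) % 3 := fun i =>
    hpart _ _ (by simp [p]) (by simp [p])
  have hq : ∀ i, (f (Sum.inl (q i)) : ℕ) % 3 = (f (Sum.inl (p o)) : ℕ) % 3 := fun i =>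
    hpart _ _ (by simp [q]) (by simp [p])
  have hr : ∀ j, (f (Sum.inr j) : ℕ) % 3 = (f (Sum.inl (p o)) : ℕ) % 3 := by
    intro j
    have h1 := hmod (by simp) (by simp) (by simpa using hpq o o) (hT j o o)
    have h2 := hq o
    omega
  let g : Fin t ⊕ Fin s ⊕ Fin s → Fin (3 * m) ⊕ Fin t :=
    Sum.elim Sum.inr (Sum.elim (fun i => Sum.inl (p i)) (fun i => Sum.inl (q i)))
  have hg : Function.Injective g := by
    rintro (i | i | i) (j | j | j) h <;> simp [g, p, q, Fin.ext_iff] at h ⊢ <;> omega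
  refine hfree ⟨(f (Sum.inl (p o)) : ℕ) % 3, Nat.mod_lt _ (by norm_num)⟩
    ⟨Function.Embedding.trans ⟨g, hg⟩ f, fun e he => ?_⟩
  obtain ⟨⟨j, i, k⟩, -, rfl⟩ := Finset.mem_image.1 he
  rw [image_triple, Finset.mem_filter]
  refine ⟨image_triple f _ _ _ ▸ hf _ (hT j i k), ?_⟩
  simp only [turanPart, Finset.insert_subset_iff, Finset.singleton_subset_iff,
    Finset.mem_filter, Finset.mem_univ, true_and]
  exact ⟨hr j, hp i, hq k⟩
end
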